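/- arXiv:1601.06269 — 7 statements merged into one kernel-verified Lean document; each statement's English description precedes it below -/
import Mathlib

section
/- Let x = (x_1, …, x_n) be a real unit vector with x_1 ≥ x_2 ≥ … ≥ x_n ≥ 0, and let s_n = ∑_{j=1}^n x_j. Then the unique incoherent state D attaining min_{δ incoherent} ‖|x⟩⟨x| − δ‖_tr is invertible — in which case it must equal diag(d_1, …, d_n) with d_j = (1 − s_n·(s_n − n·x_j))/n for j = 1, …, n — if and only if 1 > s_n·(s_n − n·x_n). -/
open Matrix BigOperators
open scoped ComplexOrder

/-- The trace norm of a Hermitian matrix: the sum of the absolute values of its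
eigenvalues (junk value `0` for non-Hermitian matrices). -/
noncomputable def traceNorm {m : Type*} [Fintype m] [DecidableEq m] (A : Matrix m m ℂ) : ℝ :=
  if h : A.IsHermitian then ∑ i, |h.eigenvalues i| else 0

/-- The operator norm of a Hermitian matrix: the maximum of the absolute values of its
eigenvalues (junk value `0` for non-Hermitian matrices). -/
noncomputable def opNorm {m : Type*} [Fintype m] [DecidableEq m] (A : Matrix m m ℂ) : ℝ :=
  if h : A.IsHermitian then ⨆ i, |h.eigenvalues i| else 0

/-- A density matrix: positive semidefinite with trace 1. -/
def IsDensity {m : Type*} [Fintype m] (A : Matrix m m ℂ) : Prop :=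
  A.PosSemidef ∧ A.trace = 1

/-- An incoherent state: a diagonal density matrix. -/
def IsIncoherent {m : Type*} [Fintype m] [DecidableEq m] (A : Matrix m m ℂ) : Prop :=
  IsDensity A ∧ ∀ i j, i ≠ j → A i j = 0

/-- `|x⟩⟨x|`, the rank-one matrix with `(i,j)` entry `x i * conj (x j)`. -/
def outer {m : Type*} (x : m → ℂ) : Matrix m m ℂ :=
  Matrix.of fun i j => x i * star (x j)

/-- `ent x ℓ` is the 1-based entry `x_ℓ` of `x` (junk value `0` outside `{1,…,n}`). -/
noncomputable def ent {n : ℕ} (x : Fin n → ℝ) (ℓ : ℕ) : ℝ :=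
  if h : 1 ≤ ℓ ∧ ℓ ≤ n then x ⟨ℓ - 1, by omega⟩ else 0

/-- `s_ℓ = ∑_{j=1}^{ℓ} x_j`. -/
noncomputable def sVal {n : ℕ} (x : Fin n → ℝ) (ℓ : ℕ) : ℝ :=
  ∑ j ∈ Finset.Icc 1 ℓ, ent x j

/-- `m_ℓ = ∑_{j=ℓ+1}^{n} x_j²`. -/
noncomputable def mVal {n : ℕ} (x : Fin n → ℝ) (ℓ : ℕ) : ℝ :=
  ∑ j ∈ Finset.Icc (ℓ + 1) n, (ent x j) ^ 2

/-- `p_ℓ = s_ℓ² − 1 − ℓ·m_ℓ`. -/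
noncomputable def pVal {n : ℕ} (x : Fin n → ℝ) (ℓ : ℕ) : ℝ :=
  (sVal x ℓ) ^ 2 - 1 - ℓ * mVal x ℓ

/-- `q_ℓ = (p_ℓ + √(p_ℓ² + 4·ℓ·m_ℓ·s_ℓ²)) / (2·ℓ·s_ℓ)`. -/
noncomputable def qVal {n : ℕ} (x : Fin n → ℝ) (ℓ : ℕ) : ℝ :=
  (pVal x ℓ + Real.sqrt ((pVal x ℓ) ^ 2 + 4 * ℓ * mVal x ℓ * (sVal x ℓ) ^ 2)) /
    (2 * ℓ * sVal x ℓ)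

/-- The incoherent candidate `D = diag(d_1, …, d_k, 0, …, 0)` with
`d_j = (x_j − q_k)/(s_k − k·q_k)`, as a complex matrix. -/
noncomputable def DmatC {n : ℕ} (x : Fin n → ℝ) (k : ℕ) : Matrix (Fin n) (Fin n) ℂ :=
  Matrix.diagonal fun i =>
    if (i : ℕ) + 1 ≤ k then
      (((ent x ((i : ℕ) + 1) - qVal x k) / (sVal x k - k * qVal x k) : ℝ) : ℂ)
    else 0

/-- `|x⟩⟨x|` for a real vector `x`, as a complex matrix. -/
noncomputable def outerR {n : ℕ} (x : Fin n → ℝ) : Matrix (Fin n) (Fin n) ℂ :=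
  outer fun i => (x i : ℂ)

section Helpers

variable {n : ℕ}

theorem sVal_self (x : Fin n → ℝ) : sVal x n = ∑ j, x j := by
  have h : ∀ j : Fin n, x j = ent x ((j : ℕ) + 1) := fun j => by
    simp [ent, j.isLt]
  simp_rw [h]
  rw [Fin.sum_univ_eq_sum_range (fun i => ent x (i + 1)), sVal, Finset.range_eq_Ico,
    Finset.sum_Ico_add' (fun i => ent x i)]
  rfl

theorem IsIncoherent.exists_eq_diagonal {D : Matrix (Fin n) (Fin n) ℂ} (hD : IsIncoherent D) :
    ∃ d : Fin n → ℝ, (∀ i, 0 ≤ d i) ∧ ∑ i, d i = 1 ∧ D = diagonal fun i => (d i : ℂ) := by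
  obtain ⟨⟨hpos, htr⟩, hoff⟩ := hD
  have hd : ∀ i, D i i = ((D i i).re : ℂ) := fun i => by
    have := Complex.nonneg_iff.1 (hpos.diag_nonneg (i := i))
    apply Complex.ext <;> simp [this.2.symm]
  refine ⟨fun i => (D i i).re, fun i => (Complex.nonneg_iff.1 hpos.diag_nonneg).1, ?_, ?_⟩
  · have := congrArg Complex.re htr
    simpa [Matrix.trace] using this
  · ext i j
    by_cases hij : i = j
    · subst hij; simpa using hd i
    · simp [hij, hoff i j hij]

theorem isIncoherent_diagonal {d : Fin n → ℝ} (hd : ∀ i, 0 ≤ d i) (hsum : ∑ i, d i = 1) :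
    IsIncoherent (diagonal fun i => (d i : ℂ)) := by
  refine ⟨⟨PosSemidef.diagonal fun i => ?_, ?_⟩, fun i j hij => diagonal_apply_ne _ hij⟩
  · simpa using hd i
  · rw [trace_diagonal]; exact_mod_cast hsum

theorem isHermitian_outerR_sub_diagonal (x d : Fin n → ℝ) :
    (outerR x - diagonal fun i => (d i : ℂ)).IsHermitian := by
  refine IsHermitian.sub ?_ ?_
  · ext i j; simp [outerR, outer, mul_comm]
  · exact isHermitian_diagonal_of_self_adjoint _ (by ext i; simp)

theorem trace_outerR_sub_diagonal {x d : Fin n → ℝ} (hx : ∑ j, (x j) ^ 2 = 1)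
    (hd : ∑ i, d i = 1) : (outerR x - diagonal fun i => (d i : ℂ)).trace = 0 := by
  have hx' : ∑ j, (x j : ℂ) * x j = 1 := by
    rw [← Complex.ofReal_one, ← hx]; push_cast; simp [sq]
  have hd' : ∑ j, (d j : ℂ) = 1 := by exact_mod_cast hd
  simp [hd', Matrix.trace, outerR, outer, hx']

theorem star_dotProduct_outerR_sub_diagonal (x d : Fin n → ℝ) (u : Fin n → ℂ) :
    star u ⬝ᵥ ((outerR x - diagonal fun i => (d i : ℂ)) *ᵥ u) =
      ((‖∑ i, (x i : ℂ) * u i‖ ^ 2 - ∑ i, d i * ‖u i‖ ^ 2 : ℝ) : ℂ) := by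
  have h1 : outerR x *ᵥ u = fun i => (x i : ℂ) * ∑ j, (x j : ℂ) * u j := by
    ext i
    simp [mulVec, dotProduct, outerR, outer, Finset.mul_sum, mul_assoc]
  rw [sub_mulVec, dotProduct_sub, h1]
  push_cast
  congr 1
  · rw [← Complex.conj_mul', map_sum, Finset.sum_mul]
    simp only [dotProduct, Pi.star_apply, map_mul, Complex.conj_ofReal, RCLike.star_def]
    exact Finset.sum_congr rfl fun i _ => by ring
  · simp only [dotProduct, Pi.star_apply, mulVec_diagonal, RCLike.star_def]
    refine Finset.sum_congr rfl fun i _ => ?_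
    rw [← Complex.conj_mul']; ring

theorem sum_eigenvalues_eq_zero {A : Matrix (Fin n) (Fin n) ℂ} (hA : A.IsHermitian)
    (htr : A.trace = 0) : ∑ i, hA.eigenvalues i = 0 := by
  have := hA.trace_eq_sum_eigenvalues
  rw [htr] at this
  exact Complex.ofReal_eq_zero.1 (by push_cast; exact this.symm)

theorem eigenvalues_le_half_traceNorm {A : Matrix (Fin n) (Fin n) ℂ} (hA : A.IsHermitian)
    (htr : A.trace = 0) (i : Fin n) : hA.eigenvalues i ≤ traceNorm A / 2 := by
  rw [traceNorm, dif_pos hA]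
  have h0 := sum_eigenvalues_eq_zero hA htr
  have h1 : |hA.eigenvalues i| + hA.eigenvalues i ≤
      ∑ j, (|hA.eigenvalues j| + hA.eigenvalues j) :=
    Finset.single_le_sum (f := fun j => |hA.eigenvalues j| + hA.eigenvalues j)
      (fun j _ => by linarith [neg_abs_le (hA.eigenvalues j)]) (Finset.mem_univ i)
  rw [Finset.sum_add_distrib, h0] at h1
  linarith [le_abs_self (hA.eigenvalues i)]

theorem posSemidef_smul_one_sub {A : Matrix (Fin n) (Fin n) ℂ} (hA : A.IsHermitian) {c : ℝ}
    (hc : ∀ i, hA.eigenvalues i ≤ c) :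
    (diagonal (fun _ => (c : ℂ)) - A).PosSemidef := by
  have hU : (hA.eigenvectorUnitary : Matrix (Fin n) (Fin n) ℂ) *
      (hA.eigenvectorUnitary : Matrix (Fin n) (Fin n) ℂ)ᴴ = 1 :=
    Unitary.coe_mul_star_self hA.eigenvectorUnitary
  have h : diagonal (fun _ => (c : ℂ)) - A = (hA.eigenvectorUnitary : Matrix (Fin n) (Fin n) ℂ) *
      diagonal (fun i => ((c - hA.eigenvalues i : ℝ) : ℂ)) *
      (hA.eigenvectorUnitary : Matrix (Fin n) (Fin n) ℂ)ᴴ := by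
    have h1 : diagonal (fun i => ((c - hA.eigenvalues i : ℝ) : ℂ)) =
        (c : ℂ) • (1 : Matrix (Fin n) (Fin n) ℂ) -
          diagonal (fun i => (hA.eigenvalues i : ℂ)) := by
      ext i j; by_cases hij : i = j <;> simp [hij]
    have h2 : (diagonal (fun _ => (c : ℂ)) : Matrix (Fin n) (Fin n) ℂ) = (c : ℂ) • 1 := by
      ext i j; by_cases hij : i = j <;> simp [hij]
    have h3 := hA.spectral_theorem
    rw [Unitary.conjStarAlgAut_apply] at h3
    rw [h1, mul_sub, sub_mul, Matrix.mul_smul, Matrix.smul_mul, Matrix.mul_one, hU, h2]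
    congr 1
  rw [h]
  exact (PosSemidef.diagonal fun i => by
    simpa [← Complex.ofReal_sub] using hc i).mul_mul_conjTranspose_same _

theorem sq_sum_le_of_traceNorm {x d : Fin n → ℝ} (hx : ∑ j, (x j) ^ 2 = 1)
    (hd : ∑ i, d i = 1) (v : Fin n → ℝ) :
    (∑ i, x i * v i) ^ 2 ≤
      ∑ i, (traceNorm (outerR x - diagonal fun i => (d i : ℂ)) / 2 + d i) * v i ^ 2 := by
  set A := outerR x - diagonal fun i => (d i : ℂ) with hAdef
  have hA : A.IsHermitian := isHermitian_outerR_sub_diagonal x d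
  have hp := posSemidef_smul_one_sub hA
    (eigenvalues_le_half_traceNorm hA (trace_outerR_sub_diagonal hx hd))
  set c := traceNorm A / 2
  have h := hp.dotProduct_mulVec_nonneg (fun i => (v i : ℂ))
  rw [sub_mulVec, dotProduct_sub, hAdef, star_dotProduct_outerR_sub_diagonal] at h
  have e1 : star (fun i => (v i : ℂ)) ⬝ᵥ
      ((diagonal (fun _ => (c : ℂ)) : Matrix (Fin n) (Fin n) ℂ) *ᵥ fun i => (v i : ℂ)) =
      ((∑ i, c * v i ^ 2 : ℝ) : ℂ) := by
    simp only [dotProduct, Pi.star_apply, mulVec_diagonal, RCLike.star_def, Complex.conj_ofReal]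
    push_cast
    exact Finset.sum_congr rfl fun i _ => by ring
  have e2 : ‖∑ i, (x i : ℂ) * (v i : ℂ)‖ ^ 2 = (∑ i, x i * v i) ^ 2 := by
    rw [← sq_abs (∑ i, x i * v i), ← Real.norm_eq_abs, ← Complex.norm_real]
    push_cast; rfl
  rw [e1, e2, ← Complex.ofReal_sub, Complex.zero_le_real] at h
  simp only [Complex.norm_real, Real.norm_eq_abs, sq_abs] at h
  simp only [add_mul, Finset.sum_add_distrib]
  linarith

theorem star_eigenvector_dotProduct {A : Matrix (Fin n) (Fin n) ℂ} (hA : A.IsHermitian)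
    (i j : Fin n) : star (hA.eigenvectorBasis i : Fin n → ℂ) ⬝ᵥ (hA.eigenvectorBasis j : Fin n → ℂ)
      = if i = j then 1 else 0 := by
  have := orthonormal_iff_ite.1 hA.eigenvectorBasis.orthonormal i j
  rw [EuclideanSpace.inner_eq_star_dotProduct, dotProduct_comm] at this
  exact this

theorem star_dotProduct_mulVec_add {A : Matrix (Fin n) (Fin n) ℂ} (hA : A.IsHermitian)
    {i j : Fin n} (hij : i ≠ j) (a b : ℂ) :
    star (a • (hA.eigenvectorBasis i : Fin n → ℂ) + b • (hA.eigenvectorBasis j : Fin n → ℂ)) ⬝ᵥ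
      (A *ᵥ (a • (hA.eigenvectorBasis i : Fin n → ℂ) + b • (hA.eigenvectorBasis j : Fin n → ℂ))) =
      ((‖a‖ ^ 2 * hA.eigenvalues i + ‖b‖ ^ 2 * hA.eigenvalues j : ℝ) : ℂ) := by
  rw [mulVec_add, mulVec_smul, mulVec_smul, hA.mulVec_eigenvectorBasis,
    hA.mulVec_eigenvectorBasis]
  simp only [star_add, star_smul, add_dotProduct, dotProduct_add, smul_dotProduct,
    dotProduct_smul, star_eigenvector_dotProduct, hij, hij.symm, if_true, if_false]
  push_cast
  rw [← Complex.conj_mul', ← Complex.conj_mul']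
  simp
  ring

theorem traceNorm_le_of_sum_div_le_one {x d : Fin n → ℝ} (hx : ∑ j, (x j) ^ 2 = 1)
    (hd : ∑ i, d i = 1) (hd0 : ∀ i, 0 ≤ d i) {c : ℝ} (hc : 0 ≤ c) (hcd : ∀ i, 0 < c + d i)
    (hS : ∑ i, x i ^ 2 / (c + d i) ≤ 1) :
    traceNorm (outerR x - diagonal fun i => (d i : ℂ)) ≤ 2 * c := by
  set A := outerR x - diagonal fun i => (d i : ℂ) with hAdef
  have hA : A.IsHermitian := isHermitian_outerR_sub_diagonal x d
  have hform : ∀ u : Fin n → ℂ, ‖∑ i, (x i : ℂ) * u i‖ ^ 2 ≤ ∑ i, (c + d i) * ‖u i‖ ^ 2 := by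
    intro u
    have h1 : ‖∑ i, (x i : ℂ) * u i‖ ≤ ∑ i, |x i| * ‖u i‖ := by
      refine (norm_sum_le _ _).trans (le_of_eq ?_)
      simp
    have h2 : (∑ i, |x i| * ‖u i‖) ^ 2 ≤
        (∑ i, x i ^ 2 / (c + d i)) * ∑ i, (c + d i) * ‖u i‖ ^ 2 := by
      refine Finset.sum_sq_le_sum_mul_sum_of_sq_le_mul _
        (fun i _ => div_nonneg (sq_nonneg _) (hcd i).le)
        (fun i _ => mul_nonneg (hcd i).le (sq_nonneg _)) fun i _ => le_of_eq ?_
      have := (hcd i).ne'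
      rw [mul_pow, sq_abs]; field_simp
    have h3 : 0 ≤ ∑ i, (c + d i) * ‖u i‖ ^ 2 :=
      Finset.sum_nonneg fun i _ => mul_nonneg (hcd i).le (sq_nonneg _)
    calc _ ≤ (∑ i, |x i| * ‖u i‖) ^ 2 := by gcongr
      _ ≤ _ := h2
      _ ≤ 1 * _ := mul_le_mul_of_nonneg_right hS h3
      _ = _ := one_mul _
  have heig : ∀ i, hA.eigenvalues i =
      ‖∑ k, (x k : ℂ) * hA.eigenvectorBasis i k‖ ^ 2 -
        ∑ k, d k * ‖hA.eigenvectorBasis i k‖ ^ 2 := by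
    intro i
    have h := star_dotProduct_outerR_sub_diagonal x d (hA.eigenvectorBasis i)
    rw [← hAdef, hA.mulVec_eigenvectorBasis, dotProduct_smul, star_eigenvector_dotProduct,
      if_pos rfl] at h
    apply Complex.ofReal_injective
    rw [← h]; simp
  have hnorm : ∀ i, ∑ k, ‖hA.eigenvectorBasis i k‖ ^ 2 = 1 := fun i => by
    rw [← EuclideanSpace.norm_sq_eq, hA.eigenvectorBasis.orthonormal.1 i, one_pow]
  have hle : ∀ i, hA.eigenvalues i ≤ c := fun i => by
    have h := hform (hA.eigenvectorBasis i)
    simp only [add_mul, Finset.sum_add_distrib, ← Finset.mul_sum, hnorm] at h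
    linarith [heig i]
  have huniq : ∀ i j, 0 < hA.eigenvalues i → 0 < hA.eigenvalues j → i = j := by
    intro i j hi hj
    by_contra hij
    set a := ∑ k, (x k : ℂ) * hA.eigenvectorBasis j k with ha
    set b := ∑ k, (x k : ℂ) * hA.eigenvectorBasis i k with hb
    have h := star_dotProduct_mulVec_add hA hij a (-b)
    replace h := (star_dotProduct_outerR_sub_diagonal x d _).symm.trans h
    replace h := Complex.ofReal_injective h
    have hz : ∑ k, (x k : ℂ) * (a • (hA.eigenvectorBasis i : Fin n → ℂ) +
        (-b) • (hA.eigenvectorBasis j : Fin n → ℂ)) k = 0 := by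
      have : ∀ k, (x k : ℂ) * (a • (hA.eigenvectorBasis i : Fin n → ℂ) +
        (-b) • (hA.eigenvectorBasis j : Fin n → ℂ)) k =
        a * (x k * hA.eigenvectorBasis i k) - b * (x k * hA.eigenvectorBasis j k) := fun k => by
          simp; ring
      rw [Finset.sum_congr rfl fun k _ => this k, Finset.sum_sub_distrib, ← Finset.mul_sum,
        ← Finset.mul_sum, ← ha, ← hb]
      ring
    rw [hz, norm_zero, zero_pow two_ne_zero] at h
    have h4 : 0 ≤ ∑ k, d k * ‖(a • (hA.eigenvectorBasis i : Fin n → ℂ) +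
        (-b) • (hA.eigenvectorBasis j : Fin n → ℂ)) k‖ ^ 2 :=
      Finset.sum_nonneg fun k _ => mul_nonneg (hd0 k) (sq_nonneg _)
    have h5 : 0 ≤ ∑ k, d k * ‖hA.eigenvectorBasis j k‖ ^ 2 :=
      Finset.sum_nonneg fun k _ => mul_nonneg (hd0 k) (sq_nonneg _)
    have h6 : 0 < ‖a‖ ^ 2 := by linarith [heig j]
    have h7 := mul_pos h6 hi
    have h8 : 0 ≤ ‖-b‖ ^ 2 * hA.eigenvalues j := by positivity
    linarith
  have hsum : ∑ i, max (hA.eigenvalues i) 0 ≤ c := by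
    by_cases hex : ∃ k, 0 < hA.eigenvalues k
    · obtain ⟨k, hk⟩ := hex
      rw [Finset.sum_eq_single k (fun i _ hik => max_eq_right
        (not_lt.1 fun hi => hik (huniq i k hi hk))) (by simp)]
      exact max_le (hle k) hc
    · push Not at hex
      rw [Finset.sum_eq_zero fun i _ => max_eq_right (hex i)]
      exact hc
  rw [traceNorm, dif_pos hA]
  have h0 := sum_eigenvalues_eq_zero hA (trace_outerR_sub_diagonal hx hd)
  have habs : ∀ i, |hA.eigenvalues i| = 2 * max (hA.eigenvalues i) 0 - hA.eigenvalues i := by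
    intro i
    rcases le_total (hA.eigenvalues i) 0 with h | h
    · rw [abs_of_nonpos h, max_eq_right h]; ring
    · rw [abs_of_nonneg h, max_eq_left h]; ring
  rw [Finset.sum_congr rfl fun i _ => habs i, Finset.sum_sub_distrib, h0, ← Finset.mul_sum]
  linarith

theorem eq_zero_of_forall_linear_add_quadratic_nonneg {b c : ℝ}
    (h : ∀ t : ℝ, 0 ≤ t * b + t ^ 2 * c) : b = 0 := by
  have hd := discrim_le_zero (a := c) (b := b) (c := 0) fun t => by linarith [h t]
  rw [discrim] at hd
  nlinarith [sq_nonneg b]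

theorem eq_mul_sum_of_forall_sq_sum_le {x y : Fin n → ℝ}
    (h : ∀ v : Fin n → ℝ, (∑ i, x i * v i) ^ 2 ≤ ∑ i, y i * v i ^ 2)
    (hy : ∑ i, y i ≤ (∑ i, x i) ^ 2) (i : Fin n) : y i = x i * ∑ j, x j := by
  suffices 2 * (y i - x i * ∑ j, x j) = 0 by linarith
  refine eq_zero_of_forall_linear_add_quadratic_nonneg (c := y i - x i ^ 2) fun t => ?_
  have h1 := h fun j => 1 + t * (if j = i then 1 else 0)
  have e1 : ∑ j, x j * (1 + t * (if j = i then 1 else 0)) = ∑ j, x j + t * x i := by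
    simp [mul_add, Finset.sum_add_distrib, mul_comm]
  have e2 : ∑ j, y j * (1 + t * (if j = i then 1 else 0)) ^ 2 =
      ∑ j, y j + (2 * t + t ^ 2) * y i := by
    have : ∀ j, y j * (1 + t * (if j = i then 1 else 0)) ^ 2 =
        y j + if j = i then (2 * t + t ^ 2) * y j else 0 := fun j => by
      split_ifs <;> ring
    rw [Finset.sum_congr rfl fun j _ => this j, Finset.sum_add_distrib,
      Finset.sum_ite_eq' Finset.univ i]
    simp
  rw [e1, e2] at h1
  nlinarith

theorem one_le_sum_of_sum_sq_eq_one {x : Fin n → ℝ} (hx : ∑ j, (x j) ^ 2 = 1)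
    (hx0 : ∀ j, 0 ≤ x j) : 1 ≤ ∑ j, x j := by
  have h := Finset.sum_sq_le_sq_sum_of_nonneg (s := Finset.univ) fun j _ => hx0 j
  have h0 := Finset.sum_nonneg (s := Finset.univ) fun j _ => hx0 j
  rw [hx] at h
  nlinarith

theorem sq_div_convex_comb_le {a y k t : ℝ} (ha : 0 ≤ a) (hy : 0 < y) (hk : 0 < k) (ht0 : 0 ≤ t)
    (ht1 : t < 1) :
    a ^ 2 / ((1 - t) * y + t * (a * k)) ≤ (1 - t) * (a ^ 2 / y) + t * (a / k) := by
  have ht : 0 < 1 - t := by linarith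
  have hy' : 0 < (1 - t) * y + t * (a * k) := by positivity
  have h : (1 - t) * (a ^ 2 / y) + t * (a / k) - a ^ 2 / ((1 - t) * y + t * (a * k)) =
      a * t * (1 - t) * (a * k - y) ^ 2 / (y * k * ((1 - t) * y + t * (a * k))) := by
    have := hy'.ne'
    field_simp
    ring
  have h2 : 0 ≤ a * t * (1 - t) * (a * k - y) ^ 2 / (y * k * ((1 - t) * y + t * (a * k))) := by
    positivity
  linarith

theorem exists_incoherent_improvement (hn : 1 ≤ n) {x d : Fin n → ℝ}
    (hx : ∑ j, (x j) ^ 2 = 1) (hx0 : ∀ j, 0 ≤ x j) (hd : ∑ i, d i = 1) (hd0 : ∀ i, 0 < d i)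
    {c : ℝ} (hc : 0 ≤ c) (hS : ∑ i, x i ^ 2 / (c + d i) ≤ 1)
    (hlt : (∑ j, x j) ^ 2 < n * c + 1) :
    ∃ (e : Fin n → ℝ) (b : ℝ), (∀ i, 0 ≤ e i) ∧ ∑ i, e i = 1 ∧ 0 ≤ b ∧ b < c ∧
      (∀ i, 0 < b + e i) ∧ ∑ i, x i ^ 2 / (b + e i) ≤ 1 := by
  have hs1 := one_le_sum_of_sum_sq_eq_one hx hx0
  set s := ∑ j, x j with hs
  set Y := (n : ℝ) * c + 1 with hY
  have hn0 : (0 : ℝ) < n := by exact_mod_cast hn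
  have hs0 : 0 < s := by linarith
  have hY0 : 0 < Y := by positivity
  have hk : 0 < Y / s := by positivity
  obtain ⟨m, hm0, hm⟩ : ∃ m : ℝ, 0 < m ∧ ∀ i, m ≤ d i := by
    have : Nonempty (Fin n) := ⟨⟨0, hn⟩⟩
    obtain ⟨i, hi⟩ := Finite.exists_min d
    exact ⟨d i, hd0 i, hi⟩
  obtain ⟨t, ht0, ht1, ht⟩ : ∃ t : ℝ, 0 < t ∧ t < 1 ∧ t * c ≤ (1 - t) * m := by
    refine ⟨m / (m + c + 1), by positivity, (div_lt_one (by positivity)).2 (by linarith), ?_⟩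
    have : (1 - m / (m + c + 1)) * m - m / (m + c + 1) * c = m / (m + c + 1) := by
      field_simp; ring
    have h2 : 0 < m / (m + c + 1) := by positivity
    linarith
  have ht1' : 0 < 1 - t := by linarith
  set r := (1 - t) + t * (s ^ 2 / Y) with hr
  have hr0 : 0 < r := by positivity
  have hr1 : r < 1 := by
    have := mul_lt_mul_of_pos_left ((div_lt_one hY0).2 hlt) ht0
    linarith
  have hrY : r * Y = (1 - t) * Y + t * s ^ 2 := by rw [hr]; field_simp
  set y : Fin n → ℝ := fun i => (1 - t) * (c + d i) + t * (x i * (Y / s)) with hy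
  have hyc : ∀ i, c ≤ y i := fun i => by
    have h1 : 0 ≤ t * (x i * (Y / s)) :=
      mul_nonneg ht0.le (mul_nonneg (hx0 i) hk.le)
    have h2 : (1 - t) * m ≤ (1 - t) * d i := mul_le_mul_of_nonneg_left (hm i) ht1'.le
    simp only [hy]; linarith
  have hy0 : ∀ i, 0 < y i := fun i => by
    have h1 : 0 ≤ t * (x i * (Y / s)) :=
      mul_nonneg ht0.le (mul_nonneg (hx0 i) hk.le)
    have h2 : 0 < (1 - t) * (c + d i) := mul_pos ht1' (by linarith [hd0 i])
    simp only [hy]; linarith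
  have hysum : ∑ i, y i = Y := by
    simp only [hy, Finset.sum_add_distrib, ← Finset.mul_sum, ← Finset.sum_mul, hd, ← hs]
    simp only [Finset.sum_const, Finset.card_univ, Fintype.card_fin, nsmul_eq_mul]
    field_simp
    rw [hY]; ring
  have hyS : ∑ i, x i ^ 2 / y i ≤ r := by
    calc ∑ i, x i ^ 2 / y i ≤ ∑ i, ((1 - t) * (x i ^ 2 / (c + d i)) + t * (x i / (Y / s))) :=
          Finset.sum_le_sum fun i _ =>
            sq_div_convex_comb_le (hx0 i) (by linarith [hd0 i]) hk ht0.le ht1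
      _ = (1 - t) * ∑ i, x i ^ 2 / (c + d i) + t * (s ^ 2 / Y) := by
          rw [Finset.sum_add_distrib, ← Finset.mul_sum, ← Finset.mul_sum, ← Finset.sum_div, ← hs]
          congr 2
          field_simp
      _ ≤ r := by
          have := mul_le_mul_of_nonneg_left hS ht1'.le
          linarith
  have hb : (n : ℝ) * ((r * Y - 1) / n) = r * Y - 1 := by field_simp
  refine ⟨fun i => r * y i - (r * Y - 1) / n, (r * Y - 1) / n, fun i => ?_, ?_, ?_, ?_,
    fun i => ?_, ?_⟩
  · have h1 : r * y i - (r * Y - 1) / n = r * (y i - c) + (1 - r) / n := by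
      rw [hY]; field_simp; ring
    have h2 : 0 ≤ y i - c := by linarith [hyc i]
    have h3 : 0 ≤ 1 - r := by linarith
    simp only [h1]; positivity
  · rw [Finset.sum_sub_distrib, ← Finset.mul_sum, hysum]
    simp only [Finset.sum_const, Finset.card_univ, Fintype.card_fin, nsmul_eq_mul]
    rw [hb]; ring
  · have h1 : 1 ≤ s ^ 2 := one_le_pow₀ hs1
    have h2 : (1 - t) * s ^ 2 ≤ (1 - t) * Y := mul_le_mul_of_nonneg_left hlt.le ht1'.le
    exact div_nonneg (by linarith) hn0.le
  · rw [div_lt_iff₀ hn0]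
    have := mul_lt_mul_of_pos_right hr1 hY0
    linarith
  · have := mul_pos hr0 (hy0 i)
    linarith
  · have h1 : ∀ i, x i ^ 2 / ((r * Y - 1) / n + (r * y i - (r * Y - 1) / n)) =
        x i ^ 2 / y i / r := fun i => by
      rw [add_sub_cancel, div_div, mul_comm]
    rw [Finset.sum_congr rfl fun i _ => h1 i, ← Finset.sum_div, div_le_one hr0]
    exact hyS

end Helpers

/-- the unique incoherent state `D` attaining
`min_{δ incoherent} ‖|x⟩⟨x| − δ‖_tr` is invertible — in which case it equals
`diag(d_1,…,d_n)` with `d_j = (1 − s_n(s_n − n·x_j))/n` — iff `1 > s_n(s_n − n·x_n)`. -/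
theorem stmt11 {n : ℕ} (hn : 1 ≤ n) (x : Fin n → ℝ)
    (hunit : ∑ j, (x j) ^ 2 = 1)
    (hmono : ∀ i j : Fin n, i ≤ j → x j ≤ x i)
    (hnonneg : ∀ j, 0 ≤ x j)
    (D : Matrix (Fin n) (Fin n) ℂ) (hD : IsIncoherent D)
    (hmin : ∀ δ, IsIncoherent δ →
      traceNorm (outerR x - D) ≤ traceNorm (outerR x - δ)) :
    (IsUnit D ↔ 1 > sVal x n * (sVal x n - n * ent x n)) ∧
    (IsUnit D →
      D = Matrix.diagonal fun j : Fin n =>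
        (((1 - sVal x n * (sVal x n - n * x j)) / n : ℝ) : ℂ)) := by
  have hn0 : (0 : ℝ) < n := by exact_mod_cast hn
  have hs1 := one_le_sum_of_sum_sq_eq_one hunit hnonneg
  have hent : ent x n = x ⟨n - 1, by omega⟩ := by simp [ent, hn]
  rw [sVal_self, hent]
  set s := ∑ j, x j with hs
  obtain ⟨d, hd0, hd1, rfl⟩ := hD.exists_eq_diagonal
  set c := traceNorm (outerR x - diagonal fun i => (d i : ℂ)) / 2 with hc
  have hQ : ∀ v : Fin n → ℝ, (∑ i, x i * v i) ^ 2 ≤ ∑ i, (c + d i) * v i ^ 2 :=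
    sq_sum_le_of_traceNorm hunit hd1
  have hsum : ∑ i, (c + d i) = n * c + 1 := by
    simp [Finset.sum_add_distrib, hd1]
  have hc0 : 0 ≤ c := by
    have h := hQ fun _ => 1
    simp only [mul_one, one_pow, hsum, ← hs] at h
    have h1 : 1 ≤ s ^ 2 := one_le_pow₀ hs1
    exact nonneg_of_mul_nonneg_right (by linarith : 0 ≤ (n : ℝ) * c) hn0
  have hunitD : IsUnit (diagonal fun i => (d i : ℂ)) ↔ ∀ i, d i ≠ 0 := by
    simp [isUnit_diagonal, Pi.isUnit_iff]
  have hformula : n * c + 1 ≤ s ^ 2 → ∀ i, d i = (1 - s * (s - n * x i)) / n := by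
    intro h i
    have h1 : ∀ i, c + d i = x i * s := eq_mul_sum_of_forall_sq_sum_le hQ (by rw [hsum]; exact h)
    have h2 : n * c + 1 = s ^ 2 := by
      rw [← hsum, Finset.sum_congr rfl fun i _ => h1 i, ← Finset.sum_mul, ← hs, sq]
    rw [eq_div_iff hn0.ne']
    linear_combination (n : ℝ) * h1 i - h2
  have hforward : (∀ i, d i ≠ 0) → n * c + 1 ≤ s ^ 2 := by
    intro hne
    have hdpos : ∀ i, 0 < d i := fun i => (hd0 i).lt_of_ne (hne i).symm
    have hypos : ∀ i, 0 < c + d i := fun i => by linarith [hdpos i]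
    by_contra! hlt
    have hS : ∑ i, x i ^ 2 / (c + d i) ≤ 1 := by
      have h := hQ fun i => x i / (c + d i)
      have e1 : ∀ i, x i * (x i / (c + d i)) = x i ^ 2 / (c + d i) := fun i => by ring
      have e2 : ∀ i, (c + d i) * (x i / (c + d i)) ^ 2 = x i ^ 2 / (c + d i) := fun i => by
        have := (hypos i).ne'
        field_simp
      rw [Finset.sum_congr rfl fun i _ => e1 i, Finset.sum_congr rfl fun i _ => e2 i] at h
      by_contra! h1
      nlinarith
    obtain ⟨e, b, he0, he1, hb0, hbc, hbe, hSe⟩ :=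
      exists_incoherent_improvement hn hunit hnonneg hd1 hdpos hc0 hS hlt
    have h1 := hmin _ (isIncoherent_diagonal he0 he1)
    have h2 := traceNorm_le_of_sum_div_le_one hunit he1 he0 hb0 hbe hSe
    linarith
  rw [hunitD]
  refine ⟨⟨fun h => ?_, fun h => ?_⟩, fun h => ?_⟩
  · have h1 := hformula (hforward h) ⟨n - 1, by omega⟩
    have h2 := (hd0 ⟨n - 1, by omega⟩).lt_of_ne (h _).symm
    rw [h1, lt_div_iff₀ hn0] at h2
    linarith
  · set e : Fin n → ℝ := fun i => (1 - s * (s - n * x i)) / n with he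
    have he0 : ∀ i, 0 < e i := fun i => by
      have h1 : x ⟨n - 1, by omega⟩ ≤ x i := hmono _ _ (Fin.mk_le_mk.2 (by omega))
      have h2 : s * n * x ⟨n - 1, by omega⟩ ≤ s * n * x i :=
        mul_le_mul_of_nonneg_left h1 (by positivity)
      exact div_pos (by linarith) hn0
    have hbe : ∀ i, (s ^ 2 - 1) / n + e i = x i * s := fun i => by
      simp only [he]; field_simp; ring
    have hb0 : 0 ≤ (s ^ 2 - 1) / n := div_nonneg (by linarith [one_le_pow₀ (n := 2) hs1]) hn0.le
    have he1 : ∑ i, e i = 1 := by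
      have h1 := Finset.sum_congr rfl fun i (_ : i ∈ Finset.univ) => hbe i
      rw [Finset.sum_add_distrib, ← Finset.sum_mul, ← hs] at h1
      simp only [Finset.sum_const, Finset.card_univ, Fintype.card_fin, nsmul_eq_mul] at h1
      rw [mul_div_cancel₀ _ hn0.ne'] at h1
      linarith
    have hS : ∑ i, x i ^ 2 / ((s ^ 2 - 1) / n + e i) ≤ 1 := by
      have h1 : ∀ i, x i ^ 2 / ((s ^ 2 - 1) / n + e i) = x i / s := fun i => by
        have h2 : 0 < x i * s := by rw [← hbe i]; linarith [he0 i]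
        have h3 : x i ≠ 0 := fun h0 => by simp [h0] at h2
        rw [hbe i]; field_simp
      rw [Finset.sum_congr rfl fun i _ => h1 i, ← Finset.sum_div, ← hs, div_self (by linarith)]
    have h1 := hmin _ (isIncoherent_diagonal (fun i => (he0 i).le) he1)
    have h2 := traceNorm_le_of_sum_div_le_one hunit he1 (fun i => (he0 i).le) hb0
      (fun i => by linarith [he0 i]) hS
    have h3 : c ≤ (s ^ 2 - 1) / n := by linarith
    rw [le_div_iff₀ hn0] at h3
    intro i
    rw [hformula (by linarith) i]
    exact (he0 i).ne'
  · have h1 := hformula (hforward h)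
    congr 1
    ext i
    rw [h1 i]
end

section
/- For an n×n density matrix ρ, equality C_tr(ρ) = 2 − 2/n holds in the bound C_tr(ρ) ≤ 2 − 2/n if and only if ρ = |x⟩⟨x| for some unit vector x ∈ ℂ^n with |x_i| = 1/√n for every i (i.e., ρ is a maximally coherent pure state). -/
open Matrix BigOperators
open scoped ComplexOrder

namespace TraceCoherence

theorem re_natCast_mul (n : ℕ) (z : ℂ) : ((n : ℂ) * z).re = n * z.re := by
  rw [← Complex.ofReal_natCast, Complex.re_ofReal_mul]

variable {m : Type*} [Fintype m] [DecidableEq m]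

/-- The trace may be computed in the eigenbasis of a Hermitian matrix. -/
theorem trace_eq_sum_eigenvectorBasis {A : Matrix m m ℂ} (hA : A.IsHermitian)
    (B : Matrix m m ℂ) :
    B.trace = ∑ k, star (⇑(hA.eigenvectorBasis k)) ⬝ᵥ B *ᵥ ⇑(hA.eigenvectorBasis k) := by
  have hU : (hA.eigenvectorUnitary : Matrix m m ℂ) *
      star (hA.eigenvectorUnitary : Matrix m m ℂ) = 1 := Unitary.coe_mul_star_self _
  have h : (star (hA.eigenvectorUnitary : Matrix m m ℂ) *
      (B * (hA.eigenvectorUnitary : Matrix m m ℂ))).trace = B.trace := by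
    rw [Matrix.trace_mul_comm, Matrix.mul_assoc, hU, Matrix.mul_one]
  rw [← h]
  rfl

theorem traceNorm_eq_two_mul_sum_pos {A : Matrix m m ℂ} (hA : A.IsHermitian)
    (htr : A.trace = 0) : traceNorm A = 2 * ∑ k, max (hA.eigenvalues k) 0 := by
  have h0 : ∑ k, hA.eigenvalues k = 0 := by
    have := hA.trace_eq_sum_eigenvalues
    rw [htr] at this
    exact Complex.ofReal_injective (by simpa using this.symm)
  have h1 : traceNorm A = ∑ k, (|hA.eigenvalues k| + hA.eigenvalues k) := by
    rw [traceNorm, dif_pos hA, Finset.sum_add_distrib, h0, add_zero]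
  rw [h1, Finset.mul_sum]
  refine Finset.sum_congr rfl fun k _ => ?_
  rcases le_total (hA.eigenvalues k) 0 with h | h
  · rw [abs_of_nonpos h, max_eq_right h]; ring
  · rw [abs_of_nonneg h, max_eq_left h]; ring

theorem traceNorm_nonneg (A : Matrix m m ℂ) : 0 ≤ traceNorm A := by
  unfold traceNorm
  split_ifs
  · positivity
  · exact le_rfl

/-- The expectation of a positive semidefinite matrix in an eigenvector is at most its trace. -/
theorem re_dotProduct_le_re_trace {A ρ : Matrix m m ℂ} (hA : A.IsHermitian)
    (hρ : ρ.PosSemidef) (k : m) :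
    (star (⇑(hA.eigenvectorBasis k)) ⬝ᵥ ρ *ᵥ ⇑(hA.eigenvectorBasis k)).re ≤ ρ.trace.re := by
  rw [trace_eq_sum_eigenvectorBasis hA ρ, Complex.re_sum]
  exact Finset.single_le_sum
    (f := fun k => (star (⇑(hA.eigenvectorBasis k)) ⬝ᵥ ρ *ᵥ ⇑(hA.eigenvectorBasis k)).re)
    (fun k _ => hρ.re_dotProduct_nonneg _) (Finset.mem_univ k)

/-- Duality lower bound for the trace norm of a traceless Hermitian matrix. -/
theorem two_mul_re_trace_mul_le_traceNorm {A ρ : Matrix m m ℂ} (hA : A.IsHermitian)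
    (htr : A.trace = 0) (hρ : IsDensity ρ) : 2 * (ρ * A).trace.re ≤ traceNorm A := by
  rw [traceNorm_eq_two_mul_sum_pos hA htr, trace_eq_sum_eigenvectorBasis hA, Complex.re_sum]
  gcongr with k
  have h1 := re_dotProduct_le_re_trace hA hρ.1 k
  have h0 : 0 ≤ (star (⇑(hA.eigenvectorBasis k)) ⬝ᵥ ρ *ᵥ ⇑(hA.eigenvectorBasis k)).re :=
    hρ.1.re_dotProduct_nonneg _
  rw [hρ.2, Complex.one_re] at h1
  rw [← Matrix.mulVec_mulVec, hA.mulVec_eigenvectorBasis, Matrix.mulVec_smul,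
    dotProduct_smul, Complex.smul_re, smul_eq_mul]
  rcases le_total (hA.eigenvalues k) 0 with h | h
  · exact (mul_nonpos_of_nonpos_of_nonneg h h0).trans (le_max_right _ _)
  · exact (mul_le_of_le_one_right h h1).trans (le_max_left _ _)

/-- The pinching inequality: `ρ ≤ card m • diag ρ`. -/
theorem posSemidef_card_smul_diagonal_sub {ρ : Matrix m m ℂ} (hρ : ρ.PosSemidef) :
    ((Fintype.card m : ℂ) • Matrix.diagonal ρ.diag - ρ).PosSemidef := by
  have hD : (Matrix.diagonal ρ.diag).IsHermitian :=
    Matrix.isHermitian_diagonal_of_self_adjoint _ (funext fun i => hρ.1.apply i i)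
  refine .of_dotProduct_mulVec_nonneg (.sub ?_ hρ.1) fun v => ?_
  · rw [Matrix.IsHermitian, Matrix.conjTranspose_smul, hD.eq]
    simp
  have h : ∑ i, ∑ j, star (Pi.single i (v i) - Pi.single j (v j)) ⬝ᵥ
      ρ *ᵥ (Pi.single i (v i) - Pi.single j (v j)) =
      2 * (star v ⬝ᵥ ((Fintype.card m : ℂ) • Matrix.diagonal ρ.diag - ρ) *ᵥ v) := by
    have e : ∀ i j, star (Pi.single i (v i) : m → ℂ) ⬝ᵥ ρ *ᵥ (Pi.single j (v j) : m → ℂ) =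
        star (v i) * (ρ i j * v j) := by
      intro i j
      simp [Pi.star_single, Matrix.mulVec_single]
      ring
    have e1 : star v ⬝ᵥ ρ *ᵥ v = ∑ i, ∑ j, star (v i) * (ρ i j * v j) := by
      simp [dotProduct, Matrix.mulVec, Finset.mul_sum]
    have e2 : star v ⬝ᵥ Matrix.diagonal ρ.diag *ᵥ v = ∑ i, star (v i) * (ρ i i * v i) := by
      simp [dotProduct, Matrix.mulVec_diagonal]
    have e3 : ∑ i, ∑ j, star (v j) * (ρ j i * v i) = ∑ i, ∑ j, star (v i) * (ρ i j * v j) :=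
      Finset.sum_comm
    simp only [star_sub, sub_dotProduct, Matrix.mulVec_sub, dotProduct_sub, e,
      Finset.sum_sub_distrib, Matrix.sub_mulVec, Matrix.smul_mulVec, dotProduct_smul, e1, e2, e3,
      Finset.sum_const, Finset.card_univ, nsmul_eq_mul, smul_eq_mul, ← Finset.mul_sum]
    ring
  have h2 : 0 ≤ 2 * (star v ⬝ᵥ ((Fintype.card m : ℂ) • Matrix.diagonal ρ.diag - ρ) *ᵥ v) := by
    rw [← h]
    exact Finset.sum_nonneg fun i _ => Finset.sum_nonneg fun j _ =>
      hρ.dotProduct_mulVec_nonneg _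
  exact le_of_mul_le_mul_left (by rwa [mul_zero]) (two_pos (α := ℂ))

theorem isHermitian_sub_diagonal_diag {ι : Type*} [DecidableEq ι] {ρ : Matrix ι ι ℂ} (hρ : ρ.IsHermitian) :
    (ρ - Matrix.diagonal ρ.diag).IsHermitian :=
  hρ.sub <| Matrix.isHermitian_diagonal_of_self_adjoint _ (funext fun i => hρ.apply i i)

theorem trace_sub_diagonal_diag (ρ : Matrix m m ℂ) :
    (ρ - Matrix.diagonal ρ.diag).trace = 0 := by
  rw [Matrix.trace_sub, Matrix.trace_diagonal]
  exact sub_self _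

theorem card_mul_eigenvalues_sub_diagonal_diag {ρ : Matrix m m ℂ} (hρ : ρ.IsHermitian) (k : m) :
    (Fintype.card m : ℝ) * (isHermitian_sub_diagonal_diag hρ).eigenvalues k =
      (Fintype.card m - 1) *
        (star (⇑((isHermitian_sub_diagonal_diag hρ).eigenvectorBasis k)) ⬝ᵥ
          ρ *ᵥ ⇑((isHermitian_sub_diagonal_diag hρ).eigenvectorBasis k)).re -
        (star (⇑((isHermitian_sub_diagonal_diag hρ).eigenvectorBasis k)) ⬝ᵥ
          ((Fintype.card m : ℂ) • Matrix.diagonal ρ.diag - ρ) *ᵥ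
            ⇑((isHermitian_sub_diagonal_diag hρ).eigenvectorBasis k)).re := by
  rw [(isHermitian_sub_diagonal_diag hρ).eigenvalues_eq]
  simp only [Matrix.sub_mulVec, Matrix.smul_mulVec, dotProduct_sub, dotProduct_smul, smul_eq_mul,
    RCLike.re_eq_complex_re, Complex.sub_re, re_natCast_mul]
  ring

theorem max_eigenvalues_sub_diagonal_diag_le {ρ : Matrix m m ℂ} (hρ : ρ.PosSemidef) (k : m) :
    max ((isHermitian_sub_diagonal_diag hρ.1).eigenvalues k) 0 ≤
      (1 - 1 / Fintype.card m : ℝ) *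
        (star (⇑((isHermitian_sub_diagonal_diag hρ.1).eigenvectorBasis k)) ⬝ᵥ
          ρ *ᵥ ⇑((isHermitian_sub_diagonal_diag hρ.1).eigenvectorBasis k)).re := by
  have hn : (1 : ℝ) ≤ Fintype.card m := by
    exact_mod_cast Fintype.card_pos_iff.2 ⟨k⟩
  have hn' : (1 : ℝ) / Fintype.card m ≤ 1 := (div_le_one (by positivity)).2 hn
  have h1 := card_mul_eigenvalues_sub_diagonal_diag hρ.1 k
  have h2 := (posSemidef_card_smul_diagonal_sub hρ).re_dotProduct_nonneg
    ⇑((isHermitian_sub_diagonal_diag hρ.1).eigenvectorBasis k)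
  have h3 := hρ.re_dotProduct_nonneg ⇑((isHermitian_sub_diagonal_diag hρ.1).eigenvectorBasis k)
  rw [RCLike.re_eq_complex_re] at h2 h3
  refine max_le ?_ (mul_nonneg (sub_nonneg.2 hn') h3)
  refine le_of_mul_le_mul_left ?_ (zero_lt_one.trans_le hn)
  rw [h1, ← mul_assoc, mul_sub, mul_one, mul_one_div_cancel (by positivity)]
  exact sub_le_self _ h2

theorem sum_re_dotProduct_eigenvectorBasis {A ρ : Matrix m m ℂ} (hA : A.IsHermitian)
    (hρ : IsDensity ρ) :
    ∑ k, (star (⇑(hA.eigenvectorBasis k)) ⬝ᵥ ρ *ᵥ ⇑(hA.eigenvectorBasis k)).re = 1 := by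
  rw [← Complex.re_sum, ← trace_eq_sum_eigenvectorBasis, hρ.2, Complex.one_re]

theorem traceNorm_sub_diagonal_diag_le {ρ : Matrix m m ℂ} (hρ : IsDensity ρ) :
    traceNorm (ρ - Matrix.diagonal ρ.diag) ≤ 2 - 2 / Fintype.card m := by
  rw [traceNorm_eq_two_mul_sum_pos (isHermitian_sub_diagonal_diag hρ.1.1)
    (trace_sub_diagonal_diag ρ)]
  have h := Finset.sum_le_sum fun k (_ : k ∈ Finset.univ) =>
    max_eigenvalues_sub_diagonal_diag_le hρ.1 k
  rw [← Finset.mul_sum, sum_re_dotProduct_eigenvectorBasis _ hρ] at h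
  linear_combination 2 * h

/-- Equality in the trace-norm bound makes the pinching defect orthogonal to `ρ`. -/
theorem card_smul_diagonal_mul_eq_mul_self {ρ : Matrix m m ℂ} (hρ : IsDensity ρ)
    (h : 2 - 2 / Fintype.card m ≤ traceNorm (ρ - Matrix.diagonal ρ.diag)) :
    (Fintype.card m : ℂ) • (Matrix.diagonal ρ.diag * ρ) = ρ * ρ := by
  rcases subsingleton_or_nontrivial m with hm | hm
  · rcases isEmpty_or_nonempty m with hm' | ⟨⟨i⟩⟩
    · exact Subsingleton.elim _ _
    · have : Unique m := uniqueOfSubsingleton i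
      have hd : Matrix.diagonal ρ.diag = ρ := by
        ext a b
        rw [Subsingleton.elim b a, Matrix.diagonal_apply_eq, Matrix.diag_apply]
      rw [hd, Fintype.card_unique, Nat.cast_one, one_smul]
  have hn : (1 : ℝ) < Fintype.card m := by exact_mod_cast Fintype.one_lt_card
  set hA := isHermitian_sub_diagonal_diag hρ.1.1 with hA'
  set M := (Fintype.card m : ℂ) • Matrix.diagonal ρ.diag - ρ with hM
  have hMp : M.PosSemidef := posSemidef_card_smul_diagonal_sub hρ.1
  rw [traceNorm_eq_two_mul_sum_pos hA (trace_sub_diagonal_diag ρ)] at h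
  have hle := fun k (_ : k ∈ Finset.univ) => max_eigenvalues_sub_diagonal_diag_le hρ.1 k
  have heq := (Finset.sum_eq_sum_iff_of_le hle).1 <| (Finset.sum_le_sum hle).antisymm <| by
    rw [← Finset.mul_sum, sum_re_dotProduct_eigenvectorBasis _ hρ]
    linear_combination h / 2
  have hv : ∀ k, (M * ρ) *ᵥ ⇑(hA.eigenvectorBasis k) = 0 := by
    intro k
    have hk := heq k (Finset.mem_univ k)
    have h1 := card_mul_eigenvalues_sub_diagonal_diag hρ.1.1 k
    rw [← hA', ← hM] at h1
    rw [← hA'] at hk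
    have hz : ∀ B : Matrix m m ℂ, B.PosSemidef → (star (⇑(hA.eigenvectorBasis k)) ⬝ᵥ
        B *ᵥ ⇑(hA.eigenvectorBasis k)).re = 0 → B *ᵥ ⇑(hA.eigenvectorBasis k) = 0 := by
      intro B hB h0
      refine (hB.dotProduct_mulVec_zero_iff _).1 (Complex.ext h0 ?_)
      exact (Complex.nonneg_iff.1 (hB.dotProduct_mulVec_nonneg _)).2.symm
    rw [← Matrix.mulVec_mulVec]
    rcases le_total (hA.eigenvalues k) 0 with h0 | h0
    · rw [max_eq_right h0, eq_comm, mul_eq_zero, sub_eq_zero, eq_comm,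
        div_eq_one_iff_eq (by positivity)] at hk
      rw [hz ρ hρ.1 (hk.resolve_left hn.ne), Matrix.mulVec_zero]
    · rw [max_eq_left h0] at hk
      have hMv : M *ᵥ ⇑(hA.eigenvectorBasis k) = 0 := by
        refine hz M hMp ?_
        rw [hk, ← mul_assoc, mul_sub, mul_one, mul_one_div_cancel (by positivity)] at h1
        linarith
      have hsum : ((Fintype.card m : ℂ) - 1) • ρ =
          (Fintype.card m : ℂ) • (ρ - Matrix.diagonal ρ.diag) + M := by
        rw [hM]; module
      have hρv : ((Fintype.card m : ℂ) - 1) • (ρ *ᵥ ⇑(hA.eigenvectorBasis k)) =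
          (Fintype.card m : ℂ) • hA.eigenvalues k • ⇑(hA.eigenvectorBasis k) := by
        rw [← Matrix.smul_mulVec, hsum, Matrix.add_mulVec, Matrix.smul_mulVec,
          hA.mulVec_eigenvectorBasis, hMv, add_zero]
      have hc : (Fintype.card m : ℂ) - 1 ≠ 0 := by
        rw [sub_ne_zero]; exact_mod_cast hn.ne'
      have := congrArg (M *ᵥ ·) hρv
      simp only [Matrix.mulVec_smul, hMv, smul_zero] at this
      exact (smul_eq_zero.1 this).resolve_left hc
  have h0 : M * ρ = 0 := by
    have hU : (hA.eigenvectorUnitary : Matrix m m ℂ) *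
        star (hA.eigenvectorUnitary : Matrix m m ℂ) = 1 := Unitary.coe_mul_star_self _
    rw [← Matrix.mul_one (M * ρ), ← hU, ← Matrix.mul_assoc]
    have : M * ρ * (hA.eigenvectorUnitary : Matrix m m ℂ) = 0 := by
      ext i k
      exact congrFun (hv k) i
    rw [this, Matrix.zero_mul]
  rw [hM, Matrix.sub_mul, Matrix.smul_mul] at h0
  exact sub_eq_zero.1 h0

theorem norm_sq_apply_le {ι : Type*} {ρ : Matrix ι ι ℂ} (hρ : ρ.PosSemidef) (i j : ι) :
    ‖ρ i j‖ ^ 2 ≤ (ρ i i).re * (ρ j j).re := by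
  have h := (hρ.submatrix ![i, j]).det_nonneg
  rw [Matrix.det_fin_two] at h
  have hi : ((ρ i i).re : ℂ) = ρ i i := hρ.1.coe_re_apply_self i
  have hj : ((ρ j j).re : ℂ) = ρ j j := hρ.1.coe_re_apply_self j
  have hij : ρ i j * ρ j i = ((‖ρ i j‖ ^ 2 : ℝ) : ℂ) := by
    rw [← hρ.1.apply j i, Complex.ofReal_pow]
    exact Complex.mul_conj' _
  simp only [Matrix.submatrix_apply, Matrix.cons_val_zero, Matrix.cons_val_one] at h
  rw [hij, ← hi, ← hj, ← Complex.ofReal_mul, ← Complex.ofReal_sub] at h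
  have := Complex.zero_le_real.1 h
  linarith

theorem mul_self_apply_self {ι : Type*} [Fintype ι] {ρ : Matrix ι ι ℂ} (hρ : ρ.IsHermitian)
    (i : ι) :
    (ρ * ρ) i i = ((∑ j, ‖ρ i j‖ ^ 2 : ℝ) : ℂ) := by
  rw [Matrix.mul_apply, Complex.ofReal_sum]
  refine Finset.sum_congr rfl fun j _ => ?_
  rw [← hρ.apply j i, Complex.ofReal_pow]
  exact Complex.mul_conj' _

/-- A density matrix attaining the bound at its own diagonal has all entries of modulus
`1 / card m`, and is idempotent. -/
theorem norm_apply_eq_and_mul_self_eq {ρ : Matrix m m ℂ} (hρ : IsDensity ρ)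
    (h : (Fintype.card m : ℂ) • (Matrix.diagonal ρ.diag * ρ) = ρ * ρ) :
    (∀ i j, ‖ρ i j‖ = 1 / Fintype.card m) ∧ ρ * ρ = ρ := by
  rcases isEmpty_or_nonempty m with hm | hm
  · exact ⟨fun i => hm.elim i, Subsingleton.elim _ _⟩
  have hn : (0 : ℝ) < Fintype.card m := by exact_mod_cast Fintype.card_pos
  have hre : ∀ i, ((ρ i i).re : ℂ) = ρ i i := fun i => hρ.1.1.coe_re_apply_self i
  have htr : ∑ i, (ρ i i).re = 1 := by
    rw [← Complex.re_sum]
    exact congrArg Complex.re hρ.2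
  have hsq : ∀ i, Fintype.card m * ((ρ i i).re * (ρ i i).re) = ∑ j, ‖ρ i j‖ ^ 2 := by
    intro i
    have := congrFun (congrFun h i) i
    rw [mul_self_apply_self hρ.1.1, Matrix.smul_apply, Matrix.diagonal_mul, Matrix.diag_apply,
      ← hre i, smul_eq_mul] at this
    exact_mod_cast this
  have hsum : ∀ i, ∑ j, (ρ i i).re * (ρ j j).re = (ρ i i).re := by
    intro i
    rw [← Finset.mul_sum, htr, mul_one]
  have hle : ∀ i ∈ Finset.univ, (ρ i i).re ≤ 1 / Fintype.card m := by
    intro i _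
    have h1 : ∑ j, ‖ρ i j‖ ^ 2 ≤ ∑ j, (ρ i i).re * (ρ j j).re :=
      Finset.sum_le_sum fun j _ => norm_sq_apply_le hρ.1 i j
    rw [← hsq, hsum] at h1
    rw [le_div_iff₀ hn]
    by_contra! hlt
    have hp : 0 < (ρ i i).re := by
      by_contra! hp
      nlinarith
    nlinarith
  have hdiag : ∀ i, (ρ i i).re = 1 / Fintype.card m := fun i =>
    (Finset.sum_eq_sum_iff_of_le hle).1 (by rw [htr]; simp [hn.ne']) i (Finset.mem_univ i)
  constructor
  · intro i j
    have h1 := (Finset.sum_eq_sum_iff_of_le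
      fun j (_ : j ∈ Finset.univ) => norm_sq_apply_le hρ.1 i j).1 (by
        rw [← hsq, hsum, hdiag]; field_simp) j (Finset.mem_univ j)
    rw [hdiag, hdiag, ← sq] at h1
    exact (pow_left_inj₀ (norm_nonneg _) (by positivity) two_ne_zero).1 h1
  · have hd : Matrix.diagonal ρ.diag = (1 / Fintype.card m : ℂ) • (1 : Matrix m m ℂ) := by
      rw [Matrix.smul_one_eq_diagonal]
      congr 1
      ext i
      rw [Matrix.diag_apply, ← hre, hdiag]
      push_cast
      rfl
    have hn' : (Fintype.card m : ℂ) ≠ 0 := by exact_mod_cast hn.ne'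
    rw [← h, hd, Matrix.smul_mul, Matrix.one_mul, smul_smul, mul_one_div_cancel hn', one_smul]

/-- In an idempotent Hermitian matrix whose entries all have modulus `1 / card m`, the terms of
`(ρ * ρ) i j` are all equal. -/
theorem card_mul_apply_mul_apply {ι : Type*} [Fintype ι] {ρ : Matrix ι ι ℂ}
    (hn : ∀ i j, ‖ρ i j‖ = 1 / Fintype.card ι) (hi : ρ * ρ = ρ) (i j k : ι) :
    Fintype.card ι * (ρ i k * ρ k j) = ρ i j := by
  have : Nonempty ι := ⟨i⟩
  have hc : (0 : ℝ) < Fintype.card ι := by exact_mod_cast Fintype.card_pos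
  have hs : ∑ l, ρ i l * ρ l j * (starRingEnd ℂ) (ρ i j) = ρ i j * (starRingEnd ℂ) (ρ i j) := by
    rw [← Finset.sum_mul, ← Matrix.mul_apply, hi]
  have h0 : ∑ l, Complex.normSq (Fintype.card ι * (ρ i l * ρ l j) - ρ i j) = 0 := by
    have h1 : ∀ l, Complex.normSq (Fintype.card ι * (ρ i l * ρ l j) - ρ i j) =
        2 * (1 / Fintype.card ι) ^ 2 -
          2 * Fintype.card ι * (ρ i l * ρ l j * (starRingEnd ℂ) (ρ i j)).re := by
      intro l
      rw [Complex.normSq_sub, Complex.normSq_eq_norm_sq, Complex.normSq_eq_norm_sq]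
      simp only [norm_mul, hn, Complex.norm_natCast, mul_assoc, re_natCast_mul]
      set t := (ρ i l * (ρ l j * (starRingEnd ℂ) (ρ i j))).re
      field_simp
      ring
    simp only [h1]
    rw [Finset.sum_sub_distrib, ← Finset.mul_sum (a := 2 * (Fintype.card ι : ℝ)),
      ← Complex.re_sum, hs,
      Complex.mul_conj, Complex.normSq_eq_norm_sq, hn]
    simp only [Finset.sum_const, Finset.card_univ, nsmul_eq_mul, Complex.ofReal_re]
    ring
  have h1 := (Finset.sum_eq_zero_iff_of_nonneg fun l _ => Complex.normSq_nonneg _).1 h0 k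
    (Finset.mem_univ k)
  exact sub_eq_zero.1 (Complex.normSq_eq_zero.1 h1)

theorem exists_eq_outer {ρ : Matrix m m ℂ} [Nonempty m] (hρ : IsDensity ρ)
    (h : (Fintype.card m : ℂ) • (Matrix.diagonal ρ.diag * ρ) = ρ * ρ) :
    ∃ x : m → ℂ, (∀ i, ‖x i‖ = 1 / Real.sqrt (Fintype.card m)) ∧ ρ = outer x := by
  obtain ⟨h1, h2⟩ := norm_apply_eq_and_mul_self_eq hρ h
  obtain ⟨k⟩ := ‹Nonempty m›
  have hs : (0 : ℝ) < Real.sqrt (Fintype.card m) :=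
    Real.sqrt_pos.2 (by exact_mod_cast Fintype.card_pos_iff.2 ⟨k⟩)
  have hs2 : Real.sqrt (Fintype.card m) * Real.sqrt (Fintype.card m) = Fintype.card m :=
    Real.mul_self_sqrt (Nat.cast_nonneg _)
  refine ⟨fun i => (Real.sqrt (Fintype.card m) : ℂ) * ρ i k, fun i => ?_, ?_⟩
  · rw [norm_mul, h1, Complex.norm_real, Real.norm_of_nonneg hs.le]
    nth_rw 2 [← hs2]
    field_simp
  · ext i j
    rw [outer, Matrix.of_apply, star_mul', hρ.1.1.apply, ← card_mul_apply_mul_apply h1 h2 i j k]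
    have hc : ((Real.sqrt (Fintype.card m) : ℝ) : ℂ) * (Real.sqrt (Fintype.card m) : ℝ) =
        Fintype.card m := by exact_mod_cast hs2
    have hst : star ((Real.sqrt (Fintype.card m) : ℝ) : ℂ) = (Real.sqrt (Fintype.card m) : ℝ) :=
      Complex.conj_ofReal _
    rw [hst, ← hc]
    ring

theorem isIncoherent_diagonal_diag {ρ : Matrix m m ℂ} (hρ : IsDensity ρ) :
    IsIncoherent (Matrix.diagonal ρ.diag) := by
  refine ⟨⟨Matrix.PosSemidef.diagonal fun i => hρ.1.diag_nonneg, ?_⟩,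
    fun i j => Matrix.diagonal_apply_ne _⟩
  rw [Matrix.trace_diagonal]
  exact hρ.2

/-- Every incoherent state is far from a maximally coherent pure state. -/
theorem le_traceNorm_outer_sub {x : m → ℂ} (hx : ∀ i, ‖x i‖ = 1 / Real.sqrt (Fintype.card m))
    (hρ : IsDensity (outer x)) {δ : Matrix m m ℂ} (hδ : IsIncoherent δ) :
    2 - 2 / Fintype.card m ≤ traceNorm (outer x - δ) := by
  have hA : (outer x - δ).IsHermitian := hρ.1.1.sub hδ.1.1.1
  have htr : (outer x - δ).trace = 0 := by rw [Matrix.trace_sub, hρ.2, hδ.1.2, sub_self]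
  refine le_trans (le_of_eq ?_) (two_mul_re_trace_mul_le_traceNorm hA htr hρ)
  have hxx : ∀ i, outer x i i = 1 / Fintype.card m := by
    intro i
    have : outer x i i = ((‖x i‖ ^ 2 : ℝ) : ℂ) := by
      rw [Complex.ofReal_pow]
      exact Complex.mul_conj' _
    rw [this, hx, div_pow, Real.sq_sqrt (Nat.cast_nonneg _)]
    push_cast
    ring
  have hout : outer x = Matrix.vecMulVec x (star x) := rfl
  have hsq : outer x * outer x = outer x := by
    have h1 : star x ⬝ᵥ x = 1 := by
      rw [dotProduct_comm, ← Matrix.trace_vecMulVec, ← hout, hρ.2]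
    rw [hout, Matrix.vecMulVec_mul_vecMulVec, h1, one_smul]
  have hδd : (outer x * δ).trace = 1 / Fintype.card m := by
    rw [Matrix.trace]
    have : ∀ i, (outer x * δ).diag i = 1 / Fintype.card m * δ i i := by
      intro i
      rw [Matrix.diag_apply, Matrix.mul_apply, Finset.sum_eq_single i, hxx]
      · intro j _ hj
        rw [hδ.2 j i hj, mul_zero]
      · simp
    rw [Finset.sum_congr rfl fun i _ => this i, ← Finset.mul_sum]
    have := hδ.1.2
    rw [Matrix.trace] at this
    simp only [Matrix.diag_apply] at this
    rw [this, mul_one]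
  rw [Matrix.mul_sub, hsq, Matrix.trace_sub, hρ.2, hδd]
  have : (1 - 1 / (Fintype.card m : ℂ)) = ((1 - 1 / Fintype.card m : ℝ) : ℂ) := by push_cast; rfl
  rw [this, Complex.ofReal_re]
  ring

end TraceCoherence

/-- for an `n × n` density matrix `ρ`, equality `C_tr(ρ) = 2 − 2/n` holds
iff `ρ = |x⟩⟨x|` for some unit vector `x` all of whose entries have absolute value
`1/√n` (i.e., `ρ` is a maximally coherent pure state). -/
theorem stmt13 {n : ℕ} (ρ : Matrix (Fin n) (Fin n) ℂ) (hρ : IsDensity ρ) :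
    sInf {r : ℝ | ∃ δ, IsIncoherent δ ∧ r = traceNorm (ρ - δ)} = 2 - 2 / n ↔
    ∃ x : Fin n → ℂ, (∑ i, ‖x i‖ ^ 2 = 1) ∧ (∀ i, ‖x i‖ = 1 / Real.sqrt n) ∧
      ρ = outer x := by
  have hne : Nonempty (Fin n) := by
    by_contra h
    rw [not_nonempty_iff] at h
    have := hρ.2
    simp [Matrix.trace] at this
  have hmem : traceNorm (ρ - Matrix.diagonal ρ.diag) ∈
      {r : ℝ | ∃ δ, IsIncoherent δ ∧ r = traceNorm (ρ - δ)} :=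
    ⟨_, TraceCoherence.isIncoherent_diagonal_diag hρ, rfl⟩
  have hle : sInf {r : ℝ | ∃ δ, IsIncoherent δ ∧ r = traceNorm (ρ - δ)} ≤
      traceNorm (ρ - Matrix.diagonal ρ.diag) :=
    csInf_le ⟨0, by rintro r ⟨δ, -, rfl⟩; exact TraceCoherence.traceNorm_nonneg _⟩ hmem
  have hcard : (Fintype.card (Fin n) : ℝ) = n := by rw [Fintype.card_fin]
  constructor
  · intro h
    rw [h, ← hcard] at hle
    obtain ⟨x, hx, rfl⟩ := TraceCoherence.exists_eq_outer hρ
      (TraceCoherence.card_smul_diagonal_mul_eq_mul_self hρ hle)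
    rw [hcard] at hx
    refine ⟨x, ?_, hx, rfl⟩
    have hn : (n : ℝ) ≠ 0 := by
      rw [← hcard]
      exact_mod_cast Fintype.card_ne_zero
    simp [hx, hn]
  · rintro ⟨x, -, hx, rfl⟩
    rw [← hcard] at hx ⊢
    refine le_antisymm (hle.trans (TraceCoherence.traceNorm_sub_diagonal_diag_le hρ)) ?_
    refine le_csInf ⟨_, hmem⟩ ?_
    rintro r ⟨δ, hδ, rfl⟩
    exact TraceCoherence.le_traceNorm_outer_sub hx hρ hδ
end

section
/- Let v be a unit vector in ℂ^n ⊗ ℂ^n (a unit vector indexed by pairs (i,j) with 1 ≤ i,j ≤ n), let λ_1, …, λ_n ≥ 0 be its Schmidt coefficients (the singular values of the n×n matrix M whose (i,j) entry is the coefficient of e_i ⊗ e_j in v), and let λ = (λ_1, …, λ_n) ∈ ℝ^n (a unit vector). Then E_tr(|v⟩⟨v|) = C_tr(|λ⟩⟨λ|), i.e., min over separable states σ of ‖|v⟩⟨v| − σ‖_tr equals min over incoherent states δ of ‖|λ⟩⟨λ| − δ‖_tr. -/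
open Matrix BigOperators
open scoped ComplexOrder

open Kronecker

/-- A separable state on `ℂ^n ⊗ ℂ^n`: an element of the convex hull of the Kronecker
products of pairs of density matrices. -/
def IsSepState {n : ℕ} (σ : Matrix (Fin n × Fin n) (Fin n × Fin n) ℂ) : Prop :=
  σ ∈ convexHull ℝ
    {M : Matrix (Fin n × Fin n) (Fin n × Fin n) ℂ |
      ∃ A B : Matrix (Fin n) (Fin n) ℂ, IsDensity A ∧ IsDensity B ∧ M = A ⊗ₖ B}

section TraceNorm

variable {m : Type*} [Fintype m] [DecidableEq m]

lemma traceNorm_nonneg (A : Matrix m m ℂ) : 0 ≤ traceNorm A := by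
  unfold traceNorm
  split_ifs
  · exact Finset.sum_nonneg fun _ _ => abs_nonneg _
  · exact le_rfl

lemma trace_conj_unitary {U : Matrix m m ℂ} (hU : U ∈ unitaryGroup m ℂ) (P : Matrix m m ℂ) :
    (Uᴴ * P * U).trace = P.trace := by
  rw [trace_mul_comm, ← mul_assoc, ← star_eq_conjTranspose, mem_unitaryGroup_iff.1 hU, one_mul]

/-- The trace norm is bounded by the total trace of any decomposition into a difference of
positive semidefinite matrices. -/
lemma traceNorm_sub_le {P Q : Matrix m m ℂ} (hP : P.PosSemidef) (hQ : Q.PosSemidef) :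
    traceNorm (P - Q) ≤ P.trace.re + Q.trace.re := by
  have h : (P - Q).IsHermitian := hP.isHermitian.sub hQ.isHermitian
  set U := (h.eigenvectorUnitary : Matrix m m ℂ)
  have hU : U ∈ unitaryGroup m ℂ := h.eigenvectorUnitary.2
  have hD : Uᴴ * (P - Q) * U = diagonal (RCLike.ofReal ∘ h.eigenvalues) := by
    rw [← h.conjStarAlgAut_star_eigenvectorUnitary, Unitary.conjStarAlgAut_star_apply]
    rfl
  have hP' := hP.conjTranspose_mul_mul_same U
  have hQ' := hQ.conjTranspose_mul_mul_same U
  rw [traceNorm, dif_pos h, ← trace_conj_unitary hU P, ← trace_conj_unitary hU Q]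
  simp only [trace, diag_apply, Complex.re_sum]
  rw [← Finset.sum_add_distrib]
  refine Finset.sum_le_sum fun i _ => ?_
  have hi := congrArg Complex.re (congrFun (congrFun hD i) i)
  simp only [mul_sub, sub_mul, Matrix.sub_apply, diagonal_apply_eq, Complex.sub_re, Function.comp_apply,
    Complex.coe_algebraMap, Complex.ofReal_re] at hi
  have h1 := (Complex.le_def.1 (hP'.diag_nonneg (i := i))).1
  have h2 := (Complex.le_def.1 (hQ'.diag_nonneg (i := i))).1
  simp only [Complex.zero_re] at h1 h2
  rw [abs_le]
  constructor <;> linarith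

/-- The Jordan decomposition attains the trace norm. -/
lemma exists_posSemidef_sub_eq {A : Matrix m m ℂ} (h : A.IsHermitian) :
    ∃ P Q : Matrix m m ℂ, P.PosSemidef ∧ Q.PosSemidef ∧ A = P - Q ∧
      P.trace.re + Q.trace.re = traceNorm A := by
  set U := (h.eigenvectorUnitary : Matrix m m ℂ) with hUdef
  have hU : Uᴴᴴ ∈ unitaryGroup m ℂ := (conjTranspose_conjTranspose U).symm ▸ h.eigenvectorUnitary.2
  have hU' : Uᴴ ∈ unitaryGroup m ℂ := Unitary.star_mem h.eigenvectorUnitary.2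
  have hA : A = Uᴴᴴ * diagonal (fun i => (h.eigenvalues i : ℂ)) * Uᴴ := by
    conv_lhs => rw [h.spectral_theorem, Unitary.conjStarAlgAut_apply]
    simp [hUdef, star_eq_conjTranspose]
    rfl
  have key (d : m → ℝ) : (Uᴴᴴ * diagonal (fun i => (d i : ℂ)) * Uᴴ).trace.re = ∑ i, d i := by
    rw [trace_conj_unitary hU']
    simp [trace]
  have hpos (d : m → ℝ) (hd : ∀ i, 0 ≤ d i) :
      (Uᴴᴴ * diagonal (fun i => (d i : ℂ)) * Uᴴ).PosSemidef :=
    (PosSemidef.diagonal fun i => by simpa using hd i).conjTranspose_mul_mul_same _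
  refine ⟨_, _, hpos (fun i => (h.eigenvalues i)⁺) fun i => posPart_nonneg _,
    hpos (fun i => (h.eigenvalues i)⁻) fun i => negPart_nonneg _, ?_, ?_⟩
  · rw [← sub_mul, ← mul_sub, diagonal_sub]
    conv_lhs => rw [hA]
    simp only [← Complex.ofReal_sub, posPart_sub_negPart]
  · rw [key, key, traceNorm, dif_pos h, ← Finset.sum_add_distrib]
    exact Finset.sum_congr rfl fun i _ => posPart_add_negPart _

end TraceNorm

lemma outer_posSemidef {m : Type*} [Fintype m] (x : m → ℂ) : (outer x).PosSemidef :=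
  posSemidef_vecMulVec_self_star x

/-- Singular value decomposition, with the singular values given as square roots of the
eigenvalues of `Mᴴ * M`. -/
lemma exists_singular_value_decomposition {n : Type*} [Fintype n] [DecidableEq n]
    (M : Matrix n n ℂ) (hM : (Mᴴ * M).IsHermitian) :
    ∃ U ∈ unitaryGroup n ℂ, ∃ Y ∈ unitaryGroup n ℂ, ∀ i j,
      M i j = ∑ k, (√(hM.eigenvalues k) : ℂ) * (U i k * Y j k) := by
  set V := (hM.eigenvectorUnitary : Matrix n n ℂ)
  have hVu : V ∈ unitaryGroup n ℂ := hM.eigenvectorUnitary.2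
  have hnn := (posSemidef_conjTranspose_mul_self M).eigenvalues_nonneg
  have hG : (M * V)ᴴ * (M * V) = diagonal (fun i => (hM.eigenvalues i : ℂ)) := by
    have := hM.conjStarAlgAut_star_eigenvectorUnitary
    rw [Unitary.conjStarAlgAut_star_apply] at this
    rw [conjTranspose_mul, ← mul_assoc, mul_assoc Vᴴ]
    exact this
  let f : n → EuclideanSpace ℂ n := fun k => WithLp.toLp 2 fun i => (M * V) i k
  have hf (k l) : inner ℂ (f k) (f l) = diagonal (fun i => (hM.eigenvalues i : ℂ)) k l := by
    rw [← hG, mul_apply]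
    simp [f, PiLp.inner_apply, mul_comm]
  let g : n → EuclideanSpace ℂ n := fun k => ((√(hM.eigenvalues k))⁻¹ : ℂ) • f k
  have hg : Orthonormal ℂ ({k | hM.eigenvalues k ≠ 0}.domRestrict g) := by
    rw [orthonormal_iff_ite]
    rintro ⟨k, hk⟩ ⟨l, hl⟩
    simp only [Set.domRestrict_apply, g, inner_smul_left, inner_smul_right, hf, Subtype.mk.injEq]
    split_ifs with h
    · subst h
      have h1 : (√(hM.eigenvalues k) : ℂ) ≠ 0 := by
        simpa [Real.sqrt_eq_zero (hnn k)] using hk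
      have h2 : (hM.eigenvalues k : ℂ) = √(hM.eigenvalues k) * √(hM.eigenvalues k) := by
        rw [← Complex.ofReal_mul, Real.mul_self_sqrt (hnn k)]
      rw [diagonal_apply_eq, map_inv₀, Complex.conj_ofReal, h2]
      field_simp
    · simp [diagonal_apply_ne _ h]
  obtain ⟨b, hb⟩ := hg.exists_orthonormalBasis_extension_of_card_eq (by simp)
  have hfb (k) : f k = (√(hM.eigenvalues k) : ℂ) • b k := by
    by_cases h : hM.eigenvalues k = 0
    · have := hf k k
      rw [diagonal_apply_eq, h, Complex.ofReal_zero, inner_self_eq_zero] at this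
      simp [this, h]
    · have h1 : (√(hM.eigenvalues k) : ℂ) ≠ 0 := by
        simpa [Real.sqrt_eq_zero (hnn k)] using h
      rw [hb k h, smul_inv_smul₀ h1]
  refine ⟨_, (EuclideanSpace.basisFun n ℂ).toMatrix_orthonormalBasis_mem_unitary b,
    V.map star, ?_, fun i j => ?_⟩
  · rw [mem_unitaryGroup_iff'] at hVu ⊢
    have := congrArg (fun X => X.map star) hVu
    ext i j
    have := congrFun (congrFun this i) j
    simp only [mul_apply, star_apply, map_apply, star_sum, star_mul', star_star] at this ⊢
    rw [this]
    simp [one_apply, apply_ite]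
  · have hMV : M = M * V * star V := by
      rw [mul_assoc, mem_unitaryGroup_iff.1 hVu, mul_one]
    conv_lhs => rw [hMV]
    rw [mul_apply]
    refine Finset.sum_congr rfl fun k _ => ?_
    have := congrArg (fun x : EuclideanSpace ℂ n => x i) (hfb k)
    simp only [f, PiLp.smul_apply, smul_eq_mul] at this
    rw [this, mul_assoc]
    rfl

section Separable

variable {n : ℕ}

lemma kronecker_isSepState {A B : Matrix (Fin n) (Fin n) ℂ} (hA : IsDensity A)
    (hB : IsDensity B) : IsSepState (A ⊗ₖ B) :=
  subset_convexHull ℝ _ ⟨A, B, hA, hB, rfl⟩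

/-- A convex property of product states holds for all separable states. -/
lemma IsSepState.of_product {C : Set (Matrix (Fin n × Fin n) (Fin n × Fin n) ℂ)}
    (hC : Convex ℝ C) (h : ∀ A B, IsDensity A → IsDensity B → A ⊗ₖ B ∈ C)
    {σ : Matrix (Fin n × Fin n) (Fin n × Fin n) ℂ} (hσ : IsSepState σ) : σ ∈ C :=
  convexHull_min (by rintro _ ⟨A, B, hA, hB, rfl⟩; exact h A B hA hB) hC hσ

lemma convex_posSemidef {m : Type*} : Convex ℝ {A : Matrix m m ℂ | A.PosSemidef} :=
  fun _ hA _ hB _ _ ha hb _ => (hA.smul ha).add (hB.smul hb)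

lemma IsDensity.conj_unitary {m : Type*} [Fintype m] [DecidableEq m] {A U : Matrix m m ℂ}
    (hA : IsDensity A) (hU : U ∈ unitaryGroup m ℂ) : IsDensity (Uᴴ * A * U) :=
  ⟨hA.1.conjTranspose_mul_mul_same U, (trace_conj_unitary hU A).trans hA.2⟩

lemma convex_isDensity {m : Type*} [Fintype m] : Convex ℝ {A : Matrix m m ℂ | IsDensity A} := by
  intro A hA B hB a b ha hb hab
  refine ⟨convex_posSemidef hA.1 hB.1 ha hb hab, ?_⟩
  rw [trace_add, trace_smul, trace_smul, hA.2, hB.2, ← add_smul, hab, one_smul]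

lemma IsDensity.kronecker {A B : Matrix (Fin n) (Fin n) ℂ} (hA : IsDensity A)
    (hB : IsDensity B) : IsDensity (A ⊗ₖ B) :=
  ⟨hA.1.kronecker hB.1, by rw [trace_kronecker, hA.2, hB.2, one_mul]⟩

lemma IsSepState.isDensity {σ : Matrix (Fin n × Fin n) (Fin n × Fin n) ℂ}
    (hσ : IsSepState σ) : IsDensity σ :=
  hσ.of_product convex_isDensity fun _ _ => IsDensity.kronecker

lemma IsSepState.conj_local_unitary {σ : Matrix (Fin n × Fin n) (Fin n × Fin n) ℂ}
    (hσ : IsSepState σ) {U Y : Matrix (Fin n) (Fin n) ℂ} (hU : U ∈ unitaryGroup (Fin n) ℂ)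
    (hY : Y ∈ unitaryGroup (Fin n) ℂ) : IsSepState ((U ⊗ₖ Y)ᴴ * σ * (U ⊗ₖ Y)) := by
  refine hσ.of_product (C := {σ | IsSepState ((U ⊗ₖ Y)ᴴ * σ * (U ⊗ₖ Y))}) ?_ ?_
  · intro A hA B hB a b ha hb hab
    have := convex_convexHull ℝ _ hA hB ha hb hab
    simpa [IsSepState, mul_add, add_mul] using this
  · intro A B hA hB
    rw [Set.mem_ofPred_eq, conjTranspose_kronecker, ← mul_kronecker_mul, ← mul_kronecker_mul]
    exact kronecker_isSepState (hA.conj_unitary hU) (hB.conj_unitary hY)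

lemma posSemidef_diagonal_sub_hadamard {m : Type*} [Fintype m] [DecidableEq m]
    {A B : Matrix m m ℂ} (hA : A.PosSemidef) (hB : B.PosSemidef) :
    (diagonal (fun i => ∑ j, A i i * B j j) - Matrix.of fun i j => A i j * B i j).PosSemidef := by
  have hdiag : (diagonal (fun i => ∑ j, A i i * B j j)).PosSemidef :=
    PosSemidef.diagonal fun i =>
      Finset.sum_nonneg fun j _ => mul_nonneg hA.diag_nonneg hB.diag_nonneg
  have hherm : (Matrix.of fun i j => A i j * B i j).IsHermitian := by
    ext i j
    simp [hA.isHermitian.apply, hB.isHermitian.apply]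
  refine .of_dotProduct_mulVec_nonneg (hdiag.isHermitian.sub hherm) fun x => ?_
  let t (i j : m) : ℂ := star (x i) * (A i i * B j j) * x i - star (x i) * (A i j * B i j) * x j
  have hform : star x ⬝ᵥ ((diagonal (fun i => ∑ j, A i i * B j j) -
      Matrix.of fun i j => A i j * B i j) *ᵥ x) = ∑ i, ∑ j, t i j := by
    simp only [sub_mulVec, dotProduct_sub, t, Finset.sum_sub_distrib]
    congr 1
    · simp [dotProduct, mulVec_diagonal, Finset.mul_sum, Finset.sum_mul, mul_assoc]
    · simp [dotProduct, mulVec, Finset.mul_sum, mul_assoc]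
  -- each symmetrized pair of terms is a value of the quadratic form of `A ⊗ Bᵀ`
  have hpair (i j : m) : 0 ≤ t i j + t j i := by
    have := (hA.kronecker hB.transpose).dotProduct_mulVec_nonneg
      (Pi.single (i, j) (x i) - Pi.single (j, i) (x j))
    convert this using 1
    simp [t, mulVec_sub, sub_dotProduct, dotProduct_sub, Pi.star_single, mulVec_single]
    ring
  have hsum : 0 ≤ (∑ i, ∑ j, t i j) + ∑ i, ∑ j, t i j := by
    nth_rw 2 [Finset.sum_comm]
    simp only [← Finset.sum_add_distrib]
    exact Finset.sum_nonneg fun i _ => Finset.sum_nonneg fun j _ => hpair i j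
  rw [hform]
  rw [Complex.le_def] at hsum ⊢
  simp only [Complex.add_re, Complex.add_im, Complex.zero_re, Complex.zero_im] at hsum ⊢
  constructor <;> linarith

/-- The block of `X` on the span of the vectors `e i ⊗ e i`. -/
def diagBlock {R m : Type*} (X : Matrix (m × m) (m × m) R) : Matrix m m R :=
  X.submatrix (fun i => (i, i)) fun i => (i, i)

/-- The diagonal part of the first marginal of `X`. -/
def dephasedMarginal {R m : Type*} [AddCommMonoid R] [Fintype m] [DecidableEq m]
    (X : Matrix (m × m) (m × m) R) : Matrix m m R :=
  diagonal fun i => ∑ j, X (i, j) (i, j)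

lemma trace_dephasedMarginal {R m : Type*} [AddCommMonoid R] [Fintype m] [DecidableEq m]
    (X : Matrix (m × m) (m × m) R) : (dephasedMarginal X).trace = X.trace := by
  simp [dephasedMarginal, trace, Fintype.sum_prod_type]

lemma dephasedMarginal_isIncoherent {m : Type*} [Fintype m] [DecidableEq m]
    {X : Matrix (m × m) (m × m) ℂ} (hX : IsDensity X) : IsIncoherent (dephasedMarginal X) :=
  ⟨⟨PosSemidef.diagonal fun _ => Finset.sum_nonneg fun _ _ => hX.1.diag_nonneg,
    (trace_dephasedMarginal X).trans hX.2⟩, fun _ _ h => diagonal_apply_ne _ h⟩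

lemma IsSepState.dephasedMarginal_sub_diagBlock
    {σ : Matrix (Fin n × Fin n) (Fin n × Fin n) ℂ} (hσ : IsSepState σ) :
    (dephasedMarginal σ - diagBlock σ).PosSemidef := by
  refine hσ.of_product (C := {σ | (dephasedMarginal σ - diagBlock σ).PosSemidef}) ?_ ?_
  · intro A (hA : PosSemidef _) B (hB : PosSemidef _) a b ha hb hab
    have := (hA.smul ha).add (hB.smul hb)
    rw [Set.mem_ofPred_eq]
    convert this using 1
    ext i j
    by_cases h : i = j
    · subst h
      simp [dephasedMarginal, diagBlock, Finset.sum_add_distrib, ← Finset.mul_sum]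
      ring
    · simp [dephasedMarginal, diagBlock, h]
      ring
  · exact fun A B hA hB => posSemidef_diagonal_sub_hadamard hA.1 hB.1

lemma trace_diagBlock_re_le {m : Type*} [Fintype m]
    {X : Matrix (m × m) (m × m) ℂ} (hX : X.PosSemidef) :
    (diagBlock X).trace.re ≤ X.trace.re := by
  simp only [diagBlock, trace, diag_apply, submatrix_apply, Complex.re_sum,
    Fintype.sum_prod_type]
  exact Finset.sum_le_sum fun i _ => Finset.single_le_sum (f := fun j => (X (i, j) (i, j)).re)
    (fun j _ => (Complex.le_def.1 hX.diag_nonneg).1) (Finset.mem_univ i)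

end Separable

section SchmidtVector

variable {n : ℕ} {v : Fin n × Fin n → ℂ} {l : Fin n → ℂ} {U Y : Matrix (Fin n) (Fin n) ℂ}

/-- A separable state is at least as far from `|v⟩⟨v|` as some incoherent state is from
`|l⟩⟨l|`, where `l` is the vector of coefficients of a Schmidt decomposition of `v`. -/
lemma exists_isIncoherent_traceNorm_le (hU : U ∈ unitaryGroup (Fin n) ℂ)
    (hY : Y ∈ unitaryGroup (Fin n) ℂ) (hv : ∀ i j, v (i, j) = ∑ k, l k * (U i k * Y j k))
    {σ : Matrix (Fin n × Fin n) (Fin n × Fin n) ℂ} (hσ : IsSepState σ) :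
    ∃ δ, IsIncoherent δ ∧ traceNorm (outer l - δ) ≤ traceNorm (outer v - σ) := by
  set W := U ⊗ₖ Y with hWdef
  have hW : W ∈ unitaryGroup (Fin n × Fin n) ℂ := kronecker_mem_unitary hU hY
  let w : Fin n × Fin n → ℂ := fun p => if p.1 = p.2 then l p.1 else 0
  have hvw : v = W *ᵥ w := by
    ext ⟨i, j⟩
    simp [hv, mulVec, dotProduct, Fintype.sum_prod_type, w, hWdef, mul_comm]
  have hwv : Wᴴ *ᵥ v = w := by
    rw [hvw, mulVec_mulVec, ← star_eq_conjTranspose, mem_unitaryGroup_iff'.1 hW, one_mulVec]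
  have hw : Wᴴ * outer v * W = outer w := by
    change Wᴴ * vecMulVec v (star v) * W = vecMulVec w (star w)
    rw [mul_vecMulVec, vecMulVec_mul, hwv, ← hwv, star_mulVec, conjTranspose_conjTranspose]
  set τ := Wᴴ * σ * W with hτdef
  have hτ : IsSepState τ := hσ.conj_local_unitary hU hY
  obtain ⟨P, Q, hP, hQ, hPQ, htr⟩ := exists_posSemidef_sub_eq
    ((outer_posSemidef v).isHermitian.sub hσ.isDensity.1.isHermitian)
  rw [← htr, ← trace_conj_unitary hW P, ← trace_conj_unitary hW Q]
  have hP' := hP.conjTranspose_mul_mul_same W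
  have hQ' := hQ.conjTranspose_mul_mul_same W
  have hPQ' : outer w - τ = Wᴴ * P * W - Wᴴ * Q * W := by
    rw [← hw, hτdef, ← sub_mul, ← mul_sub, hPQ, mul_sub, sub_mul]
  set P' := Wᴴ * P * W
  set Q' := Wᴴ * Q * W
  refine ⟨dephasedMarginal τ, dephasedMarginal_isIncoherent hτ.isDensity, ?_⟩
  have hblock : outer l - diagBlock τ = diagBlock P' - diagBlock Q' := by
    have := congrArg diagBlock hPQ'
    ext i j
    simpa [diagBlock, outer, w] using congrFun (congrFun this i) j
  have hdecomp : outer l - dephasedMarginal τ =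
      diagBlock P' - (diagBlock Q' + (dephasedMarginal τ - diagBlock τ)) := by
    rw [← sub_sub, ← hblock]
    abel
  have h1 := traceNorm_sub_le (hP'.submatrix fun i => (i, i))
    ((hQ'.submatrix fun i => (i, i)).add hτ.dephasedMarginal_sub_diagBlock)
  have h2 := congrArg (fun X => X.trace.re) hPQ'
  have h3 := congrArg (fun X => X.trace.re) hblock
  have h4 := trace_diagBlock_re_le hP'
  have h5 : (outer w).trace = (outer l).trace := by
    simp [trace, outer, w, Fintype.sum_prod_type]
  have h6 := congrArg Complex.re (trace_dephasedMarginal τ)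
  rw [hdecomp]
  refine h1.trans ?_
  change (diagBlock P').trace.re + (diagBlock Q' + _).trace.re ≤ _
  simp only [trace_add, trace_sub, Complex.add_re, Complex.sub_re, h5] at h2 h3 ⊢
  linarith

/-- An incoherent state is at least as far from `|l⟩⟨l|` as some separable state is from
`|v⟩⟨v|`, where `l` is the vector of coefficients of a Schmidt decomposition of `v`. -/
lemma exists_isSepState_traceNorm_le (hU : U ∈ unitaryGroup (Fin n) ℂ)
    (hY : Y ∈ unitaryGroup (Fin n) ℂ) (hv : ∀ i j, v (i, j) = ∑ k, l k * (U i k * Y j k))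
    {δ : Matrix (Fin n) (Fin n) ℂ} (hδ : IsIncoherent δ) :
    ∃ σ, IsSepState σ ∧ traceNorm (outer v - σ) ≤ traceNorm (outer l - δ) := by
  let K : Matrix (Fin n × Fin n) (Fin n) ℂ := Matrix.of fun p k => U p.1 k * Y p.2 k
  have hUU (k k' : Fin n) := congrFun (congrFun (mem_unitaryGroup_iff'.1 hU) k) k'
  have hYY (k k' : Fin n) := congrFun (congrFun (mem_unitaryGroup_iff'.1 hY) k) k'
  simp only [mul_apply, star_apply] at hUU hYY
  have hK : Kᴴ * K = 1 := by
    ext k k'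
    have : (Kᴴ * K) k k' = (∑ i, star (U i k) * U i k') * ∑ j, star (Y j k) * Y j k' := by
      rw [mul_apply, Fintype.sum_prod_type, Finset.sum_mul_sum]
      refine Finset.sum_congr rfl fun i _ => Finset.sum_congr rfl fun j _ => ?_
      simp [K]
      ring
    rw [this, hUU, hYY]
    by_cases h : k = k' <;> simp [one_apply, h]
  have hKl : K *ᵥ l = v := by
    ext ⟨i, j⟩
    simp [hv, K, mulVec, dotProduct, mul_comm]
  have hKtr (X : Matrix (Fin n) (Fin n) ℂ) : (K * X * Kᴴ).trace = X.trace := by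
    rw [trace_mul_comm, ← Matrix.mul_assoc, hK, Matrix.one_mul]
  have houter : K * outer l * Kᴴ = outer v := by
    change K * vecMulVec l (star l) * Kᴴ = vecMulVec v (star v)
    rw [mul_vecMulVec, vecMulVec_mul, hKl, ← hKl, star_mulVec]
  refine ⟨K * δ * Kᴴ, ?_, ?_⟩
  · have hdens {V : Matrix (Fin n) (Fin n) ℂ} {k : Fin n}
        (h : ∑ i, star (V i k) * V i k = (1 : Matrix (Fin n) (Fin n) ℂ) k k) :
        IsDensity (outer fun i => V i k) := by
      refine ⟨outer_posSemidef _, ?_⟩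
      rw [one_apply_eq] at h
      rw [← h]
      simp [trace, outer, mul_comm]
    have hsum : K * δ * Kᴴ =
        ∑ k, (δ k k).re • (outer (fun i => U i k) ⊗ₖ outer fun j => Y j k) := by
      have hdiag : δ = diagonal fun k => ((δ k k).re : ℂ) := by
        ext i j
        by_cases h : i = j
        · subst h
          have := (Complex.le_def.1 (hδ.1.1.diag_nonneg (i := i))).2
          rw [diagonal_apply_eq]
          apply Complex.ext <;> simp [← this]
        · rw [hδ.2 i j h, diagonal_apply_ne _ h]
      conv_lhs => rw [hdiag]
      ext p q
      rw [mul_apply, Matrix.sum_apply]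
      refine Finset.sum_congr rfl fun k _ => ?_
      simp [K, outer, mul_diagonal]
      ring
    rw [hsum]
    refine (convex_convexHull ℝ _).sum_mem (fun k _ => ?_) ?_ fun k _ =>
      kronecker_isSepState (hdens (hUU k k)) (hdens (hYY k k))
    · exact (Complex.le_def.1 hδ.1.1.diag_nonneg).1
    · have := congrArg Complex.re hδ.1.2
      simpa [trace] using this
  · obtain ⟨P, Q, hP, hQ, hPQ, htr⟩ := exists_posSemidef_sub_eq
      ((outer_posSemidef l).isHermitian.sub hδ.1.1.isHermitian)
    have : outer v - K * δ * Kᴴ = K * P * Kᴴ - K * Q * Kᴴ := by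
      rw [← houter, ← Matrix.sub_mul, ← Matrix.mul_sub, hPQ, Matrix.mul_sub, Matrix.sub_mul]
    rw [this, ← htr, ← hKtr P, ← hKtr Q]
    exact traceNorm_sub_le (hP.mul_mul_conjTranspose_same K) (hQ.mul_mul_conjTranspose_same K)

end SchmidtVector

/-- Two sets of nonnegative reals that are cofinal in each other downwards have the same
infimum. -/
lemma sInf_eq_sInf_of_forall_exists_le_of_nonneg {S T : Set ℝ} (hS : ∀ s ∈ S, 0 ≤ s)
    (hT : ∀ t ∈ T, 0 ≤ t) (hST : ∀ s ∈ S, ∃ t ∈ T, t ≤ s) (hTS : ∀ t ∈ T, ∃ s ∈ S, s ≤ t) :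
    sInf S = sInf T := by
  have key {S T : Set ℝ} (hS : ∀ s ∈ S, 0 ≤ s) (hT : T.Nonempty)
      (hTS : ∀ t ∈ T, ∃ s ∈ S, s ≤ t) : sInf S ≤ sInf T :=
    le_csInf hT fun t ht =>
      let ⟨_, hs, hst⟩ := hTS t ht
      (csInf_le ⟨0, hS⟩ hs).trans hst
  rcases S.eq_empty_or_nonempty with rfl | hSne
  · rcases T.eq_empty_or_nonempty with rfl | ⟨t, ht⟩
    · rfl
    · obtain ⟨s, hs, -⟩ := hTS t ht
      exact hs.elim
  · obtain ⟨s, hs⟩ := id hSne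
    obtain ⟨t, ht, -⟩ := hST s hs
    exact le_antisymm (key hS ⟨t, ht⟩ hTS) (key hT hSne hST)

/-- for a unit vector `v ∈ ℂ^n ⊗ ℂ^n` with Schmidt coefficients
`λ_1, …, λ_n` (the singular values of the coefficient matrix `M` of `v`), the trace
distance of entanglement of `|v⟩⟨v|` equals the trace distance of coherence of
`|λ⟩⟨λ|`. -/
theorem stmt14 {n : ℕ} (v : Fin n × Fin n → ℂ) (hv : ∑ p, ‖v p‖ ^ 2 = 1)
    (lam : Fin n → ℝ)
    (hM : ((Matrix.of fun i j : Fin n => v (i, j))ᴴ *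
      (Matrix.of fun i j : Fin n => v (i, j))).IsHermitian)
    (hlam : ∀ i, lam i = Real.sqrt (hM.eigenvalues i)) :
    sInf {r : ℝ | ∃ σ, IsSepState σ ∧ r = traceNorm (outer v - σ)} =
    sInf {r : ℝ | ∃ δ, IsIncoherent δ ∧
      r = traceNorm (outer (fun i => (lam i : ℂ)) - δ)} := by
  obtain ⟨U, hU, Y, hY, hUY⟩ := exists_singular_value_decomposition _ hM
  have hv' : ∀ i j, v (i, j) = ∑ k, (lam k : ℂ) * (U i k * Y j k) := by
    simpa only [hlam, of_apply] using hUY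
  apply sInf_eq_sInf_of_forall_exists_le_of_nonneg
  · rintro _ ⟨σ, -, rfl⟩
    exact traceNorm_nonneg _
  · rintro _ ⟨δ, -, rfl⟩
    exact traceNorm_nonneg _
  · rintro _ ⟨σ, hσ, rfl⟩
    obtain ⟨δ, hδ, h⟩ := exists_isIncoherent_traceNorm_le hU hY hv' hσ
    exact ⟨_, ⟨δ, hδ, rfl⟩, h⟩
  · rintro _ ⟨δ, hδ, rfl⟩
    obtain ⟨σ, hσ, h⟩ := exists_isSepState_traceNorm_le hU hY hv' hδ
    exact ⟨_, ⟨σ, hσ, rfl⟩, h⟩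
end

section
/- Let σ be a density matrix on ℂ^n ⊗ ℂ^n (indexed by pairs in {1,…,n}×{1,…,n}) with all entries real and with positive semidefinite partial transpose. Then there exists a finite family (E_t) of n × n² complex matrices with ∑_t E_t† E_t = I_{n²} such that the n×n matrix ∑_t E_t σ E_t† is diagonal, and such that for every vector λ = (λ_1, …, λ_n) ∈ ℝ^n with λ_j ≥ 0 and ∑_j λ_j² = 1, setting v = ∑_{j=1}^n λ_j e_j ⊗ e_j, one has ∑_t E_t |v⟩⟨v| E_t† = |λ⟩⟨λ|. -/
open Matrix BigOperators
open scoped ComplexOrder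

/-- The partial transpose: `σ^Γ_{(i,k),(j,ℓ)} = σ_{(j,k),(i,ℓ)}`. -/
def ptrans {n : ℕ} (σ : Matrix (Fin n × Fin n) (Fin n × Fin n) ℂ) :
    Matrix (Fin n × Fin n) (Fin n × Fin n) ℂ :=
  Matrix.of fun p q => σ (q.1, p.2) (p.1, q.2)

section Kraus

variable {m : Type*} [DecidableEq m]

/-- The coherent Kraus operator `∑ⱼ |j⟩⟨jj|`. -/
def diagKraus (m : Type*) [DecidableEq m] : Matrix m (m × m) ℂ :=
  Matrix.of fun k q => if q = (k, k) then 1 else 0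

/-- The Kraus operator `|w⟩⟨p|`, which detects the basis state `p` and prepares `w`. -/
def prepKraus (w : m → ℂ) (p : m × m) : Matrix m (m × m) ℂ :=
  Matrix.of fun k q => if q = p then w k else 0

/-- The unnormalised eigenvector, for the sign `ε = ±1`, of the two-level state supported on
`e_{p.1}, e_{p.2}` with equal populations and coherence `x / 2`; it vanishes if `p.1 = p.2`. -/
noncomputable def twoLevelVec (x ε : ℝ) (p : m × m) (k : m) : ℂ :=
  if p.1 = p.2 then 0 else
    ((√(1 + ε * x) / 2 * ((if k = p.1 then 1 else 0) + ε * (if k = p.2 then 1 else 0)) : ℝ) : ℂ)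

lemma twoLevelVec_outer {x : ℝ} (hx : |x| ≤ 1) {p : m × m} (hp : p.1 ≠ p.2) (k l : m) :
    twoLevelVec x 1 p k * star (twoLevelVec x 1 p l) +
      twoLevelVec x (-1) p k * star (twoLevelVec x (-1) p l) =
    (((if k = p.1 ∧ l = p.1 then 1 else 0) + (if k = p.2 ∧ l = p.2 then 1 else 0) +
      x * ((if k = p.1 ∧ l = p.2 then 1 else 0) + (if k = p.2 ∧ l = p.1 then 1 else 0)) : ℝ) : ℂ)
      / 2 := by
  obtain ⟨h₁, h₂⟩ := abs_le.mp hx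
  have hs₁ : √(1 + 1 * x) ^ 2 = 1 + x := by rw [Real.sq_sqrt] <;> linarith
  have hs₂ : √(1 + -1 * x) ^ 2 = 1 - x := by rw [Real.sq_sqrt] <;> linarith
  have hand (P Q : Prop) [Decidable P] [Decidable Q] : (if P ∧ Q then (1 : ℝ) else 0) =
      (if P then 1 else 0) * if Q then 1 else 0 := by
    split_ifs <;> simp_all
  simp only [twoLevelVec, if_neg hp, Complex.star_def, Complex.conj_ofReal, hand]
  generalize √(1 + 1 * x) = s at *
  generalize √(1 + -1 * x) = t at *
  generalize (if k = p.1 then (1 : ℝ) else 0) = a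
  generalize (if k = p.2 then (1 : ℝ) else 0) = b
  generalize (if l = p.1 then (1 : ℝ) else 0) = c
  generalize (if l = p.2 then (1 : ℝ) else 0) = d
  have key : s / 2 * (a + 1 * b) * (s / 2 * (c + 1 * d)) +
      t / 2 * (a + -1 * b) * (t / 2 * (c + -1 * d)) =
      (a * c + b * d + x * (a * d + b * c)) / 2 := by
    linear_combination (a + b) * (c + d) / 4 * hs₁ + (a - b) * (c - d) / 4 * hs₂
  exact_mod_cast congrArg Complex.ofReal key

variable [Fintype m]

lemma diagKraus_conj_apply (M : Matrix (m × m) (m × m) ℂ) (k l : m) :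
    (diagKraus m * M * (diagKraus m)ᴴ) k l = M (k, k) (l, l) := by
  simp [diagKraus, Matrix.mul_apply, apply_ite]

lemma diagKraus_gram : (diagKraus m)ᴴ * diagKraus m =
    Matrix.diagonal fun p : m × m => if p.1 = p.2 then (1 : ℂ) else 0 := by
  ext ⟨a, b⟩ ⟨c, d⟩
  simp only [diagKraus, Matrix.mul_apply, Matrix.conjTranspose_apply, Matrix.of_apply,
    Matrix.diagonal_apply, Prod.mk.injEq, apply_ite star, star_one, star_zero]
  rw [Finset.sum_eq_single a] <;> grind

lemma prepKraus_conj_apply (w : m → ℂ) (p : m × m) (M : Matrix (m × m) (m × m) ℂ) (k l : m) :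
    (prepKraus w p * M * (prepKraus w p)ᴴ) k l = M p p * (w k * star (w l)) := by
  simp only [prepKraus, Matrix.mul_apply, Matrix.conjTranspose_apply, Matrix.of_apply,
    apply_ite star, star_zero, ite_mul, mul_ite, zero_mul, mul_zero, Finset.sum_ite_eq',
    Finset.mem_univ, if_true]
  ring

lemma prepKraus_gram (w : m → ℂ) (p : m × m) : (prepKraus w p)ᴴ * prepKraus w p =
    Matrix.diagonal fun q => if q = p then ∑ k, star (w k) * w k else 0 := by
  ext a b
  simp only [prepKraus, Matrix.mul_apply, Matrix.conjTranspose_apply, Matrix.of_apply,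
    Matrix.diagonal_apply]
  split_ifs <;> simp_all

lemma twoLevelVec_norm {x : ℝ} (hx : |x| ≤ 1) {p : m × m} (hp : p.1 ≠ p.2) :
    ∑ k, star (twoLevelVec x 1 p k) * twoLevelVec x 1 p k +
      ∑ k, star (twoLevelVec x (-1) p k) * twoLevelVec x (-1) p k = 1 := by
  rw [← Finset.sum_add_distrib]
  have h (k : m) : star (twoLevelVec x 1 p k) * twoLevelVec x 1 p k +
      star (twoLevelVec x (-1) p k) * twoLevelVec x (-1) p k =
      (if k = p.1 then 1 / 2 else 0) + (if k = p.2 then 1 / 2 else 0) := by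
    rw [mul_comm, mul_comm (star (twoLevelVec x (-1) p k)), twoLevelVec_outer hx hp]
    by_cases h₁ : k = p.1
    · have h₂ : k ≠ p.2 := fun h => hp (h₁.symm.trans h)
      simp [h₁, hp]
    · by_cases h₂ : k = p.2
      · simp [h₂, hp.symm]
      · simp [h₁, h₂]
  simp_rw [h, Finset.sum_add_distrib]
  norm_num

/-- The Kraus family that is coherent on the states `|jj⟩` and replaces each `|ij⟩` with `i ≠ j`
by a two-level state on `e_i, e_j` with coherence `x (i, j) / 2`. -/
noncomputable def cancelKraus (x : m × m → ℝ) :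
    Option ((m × m) ⊕ (m × m)) → Matrix m (m × m) ℂ
  | none => diagKraus m
  | some (Sum.inl p) => prepKraus (twoLevelVec (x p) 1 p) p
  | some (Sum.inr p) => prepKraus (twoLevelVec (x p) (-1) p) p

lemma cancelKraus_gram {x : m × m → ℝ} (hx : ∀ p, |x p| ≤ 1) :
    ∑ t, (cancelKraus x t)ᴴ * cancelKraus x t = 1 := by
  simp only [Fintype.sum_option, Fintype.sum_sum_type, cancelKraus, diagKraus_gram,
    prepKraus_gram]
  ext a b
  simp only [Matrix.add_apply, Matrix.sum_apply, Matrix.diagonal_apply, Matrix.one_apply]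
  by_cases hab : a = b
  · simp only [hab, if_true, Finset.sum_ite_eq, Finset.mem_univ]
    by_cases hb : b.1 = b.2
    · simp [hb, twoLevelVec]
    · rw [if_neg hb, zero_add, twoLevelVec_norm (hx b) hb]
  · simp [hab]

lemma cancelKraus_conj_apply (x : m × m → ℝ) (M : Matrix (m × m) (m × m) ℂ) (k l : m) :
    (∑ t, cancelKraus x t * M * (cancelKraus x t)ᴴ) k l = M (k, k) (l, l) +
      ∑ p, M p p * (twoLevelVec (x p) 1 p k * star (twoLevelVec (x p) 1 p l) +
        twoLevelVec (x p) (-1) p k * star (twoLevelVec (x p) (-1) p l)) := by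
  simp only [Fintype.sum_option, Fintype.sum_sum_type, cancelKraus, Matrix.sum_apply,
    diagKraus_conj_apply, prepKraus_conj_apply, mul_add,
    Finset.sum_add_distrib]

lemma cancelKraus_conj_apply_of_ne {x : m × m → ℝ} (hx : ∀ p, |x p| ≤ 1)
    (M : Matrix (m × m) (m × m) ℂ) {k l : m} (hkl : k ≠ l) :
    (∑ t, cancelKraus x t * M * (cancelKraus x t)ᴴ) k l = M (k, k) (l, l) +
      (M (k, l) (k, l) * x (k, l) + M (l, k) (l, k) * x (l, k)) / 2 := by
  rw [cancelKraus_conj_apply]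
  have h (p : m × m) : M p p * (twoLevelVec (x p) 1 p k * star (twoLevelVec (x p) 1 p l) +
        twoLevelVec (x p) (-1) p k * star (twoLevelVec (x p) (-1) p l)) =
      (if p = (k, l) then M p p * x p / 2 else 0) +
        (if p = (l, k) then M p p * x p / 2 else 0) := by
    by_cases hp : p.1 = p.2
    · have h₁ : p ≠ (k, l) := by grind
      have h₂ : p ≠ (l, k) := by grind
      simp [twoLevelVec, hp, h₁, h₂]
    · rw [twoLevelVec_outer (hx p) hp]
      obtain ⟨i, j⟩ := p
      have h₁ : ¬ (k = i ∧ l = i) := by grind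
      have h₂ : ¬ (k = j ∧ l = j) := by grind
      simp only [h₁, h₂, if_false, Prod.mk.injEq, eq_comm (a := i), eq_comm (a := j)]
      simp only [and_comm (a := l = i)]
      split_ifs <;> push_cast <;> ring
  simp_rw [h, Finset.sum_add_distrib, Finset.sum_ite_eq', Finset.mem_univ, if_true]
  ring

lemma cancelKraus_conj_outer (x : m × m → ℝ) (lam : m → ℝ) :
    ∑ t, cancelKraus x t *
      outer (fun p : m × m => if p.1 = p.2 then (lam p.1 : ℂ) else 0) * (cancelKraus x t)ᴴ =
    outer fun j => (lam j : ℂ) := by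
  ext k l
  rw [cancelKraus_conj_apply, Finset.sum_eq_zero]
  · simp [outer]
  · intro p _
    by_cases hp : p.1 = p.2 <;> simp [outer, twoLevelVec, hp]

end Kraus

lemma Matrix.PosSemidef.norm_apply_sq_le {m : Type*} {A : Matrix m m ℂ} (hA : A.PosSemidef)
    (i j : m) : ‖A i j‖ ^ 2 ≤ (A i i).re * (A j j).re := by
  have h := (hA.submatrix ![i, j]).det_nonneg
  have hji : A j i = star (A i j) := (hA.isHermitian.apply j i).symm
  rw [Matrix.det_fin_two] at h
  have h' := (Complex.le_def.mp h).1
  have hii := (Complex.le_def.mp (hA.diag_nonneg (i := i))).2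
  simpa [hji, Complex.mul_re, ← hii, Complex.mul_conj, Complex.normSq_eq_norm_sq,
    ← Complex.ofReal_pow] using h'

/-- for a real-entried density matrix `σ` on `ℂ^n ⊗ ℂ^n` with positive
partial transpose, there is a finite family `(E_t)` of `n × n²` matrices with
`∑ E_t† E_t = I` such that `∑ E_t σ E_t†` is diagonal, and for every `λ` with `λ_j ≥ 0`,
`∑ λ_j² = 1` and `v = ∑ λ_j e_j ⊗ e_j`, one has `∑ E_t |v⟩⟨v| E_t† = |λ⟩⟨λ|`. -/
theorem stmt15 {n : ℕ} (σ : Matrix (Fin n × Fin n) (Fin n × Fin n) ℂ)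
    (hσ : IsDensity σ) (hreal : ∀ p q, (σ p q).im = 0)
    (hppt : (ptrans σ).PosSemidef) :
    ∃ (N : ℕ) (E : Fin N → Matrix (Fin n) (Fin n × Fin n) ℂ),
      (∑ t, (E t)ᴴ * E t = 1) ∧
      (∀ i j : Fin n, i ≠ j → (∑ t, E t * σ * (E t)ᴴ) i j = 0) ∧
      (∀ lam : Fin n → ℝ, (∀ j, 0 ≤ lam j) → (∑ j, (lam j) ^ 2 = 1) →
        (∑ t, E t *
            outer (fun p : Fin n × Fin n => if p.1 = p.2 then (lam p.1 : ℂ) else 0) *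
            (E t)ᴴ) =
          outer fun j => (lam j : ℂ)) := by
  set x : Fin n × Fin n → ℝ := fun p =>
    -(2 * (σ (p.1, p.1) (p.2, p.2)).re) / ((σ p p).re + (σ p.swap p.swap).re) with hxdef
  have hbound (i j : Fin n) : 2 * |(σ (i, i) (j, j)).re| ≤
      (σ (i, j) (i, j)).re + (σ (j, i) (j, i)).re := by
    have h := hppt.norm_apply_sq_le (j, i) (i, j)
    simp only [ptrans, Matrix.of_apply] at h
    have ha := (Complex.le_def.mp (hσ.1.diag_nonneg (i := (i, j)))).1
    have hb := (Complex.le_def.mp (hσ.1.diag_nonneg (i := (j, i)))).1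
    simp only [Complex.zero_re] at ha hb
    have hs := Complex.abs_re_le_norm (σ (i, i) (j, j))
    have hs' : ‖σ (i, i) (j, j)‖ ≤ ((σ (i, j) (i, j)).re + (σ (j, i) (j, i)).re) / 2 :=
      abs_le_of_sq_le_sq' (by nlinarith [sq_nonneg ((σ (i, j) (i, j)).re - (σ (j, i) (j, i)).re)])
        (by linarith) |>.2
    linarith
  have hx (p : Fin n × Fin n) : |x p| ≤ 1 := by
    have h := hbound p.1 p.2
    simp only [hxdef, abs_div, abs_neg, abs_mul, abs_two]
    exact div_le_one_of_le₀ (h.trans (le_abs_self _)) (abs_nonneg _)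
  have hre (p q : Fin n × Fin n) : σ p q = ((σ p q).re : ℂ) :=
    Complex.ext rfl (by simp [hreal p q])
  have hsymm (p q : Fin n × Fin n) : (σ q p).re = (σ p q).re := by
    rw [← hσ.1.isHermitian.apply p q]; simp
  let e := (Fintype.equivFin (Option ((Fin n × Fin n) ⊕ (Fin n × Fin n)))).symm
  refine ⟨_, fun t => cancelKraus x (e t), ?_, fun i j hij => ?_, fun lam _ _ => ?_⟩
  · rw [e.sum_comp fun t => (cancelKraus x t)ᴴ * cancelKraus x t]
    exact cancelKraus_gram hx
  · rw [e.sum_comp fun t => cancelKraus x t * σ * (cancelKraus x t)ᴴ,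
      cancelKraus_conj_apply_of_ne hx σ hij, hre (i, i), hre (i, j), hre (j, i)]
    have h := hbound i j
    norm_cast
    simp only [hxdef, Prod.swap_prod_mk, hsymm (i, i) (j, j)]
    rw [add_comm (σ (j, i) (j, i)).re]
    by_cases hd : (σ (i, j) (i, j)).re + (σ (j, i) (j, i)).re = 0
    · have : (σ (i, i) (j, j)).re = 0 := by
        rw [hd] at h
        exact abs_eq_zero.mp (le_antisymm (by linarith) (abs_nonneg _))
      simp [this]
    · field_simp
      ring
  · rw [e.sum_comp fun t => cancelKraus x t *
      outer (fun p : Fin n × Fin n => if p.1 = p.2 then (lam p.1 : ℂ) else 0) *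
      (cancelKraus x t)ᴴ]
    exact cancelKraus_conj_outer x lam
end

section
/- Let λ_1, …, λ_n be nonnegative real numbers with ∑_{i=1}^n λ_i = 1. Then −∑_{i=1}^n λ_i·log₂(λ_i) ≤ (∑_{i=1}^n √λ_i)² − 1, where log₂ denotes the base-2 logarithm and terms with λ_i = 0 are interpreted as 0. -/
open BigOperators

theorem one_add_sq_mul_log_sub_le {x : ℝ} (hx : 0 < x) (hx1 : x ≤ 1) :
    (1 + x ^ 2) * Real.log (1 + x ^ 2) - x ^ 2 * Real.log (x ^ 2) ≤ 2 * Real.log 2 * x := by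
  let g : ℝ → ℝ := fun t => (t + t⁻¹) * Real.log (1 + t ^ 2) - 2 * (t * Real.log t)
  have hder : ∀ t : ℝ, 0 < t →
      HasDerivAt g ((1 - (t ^ 2)⁻¹) * Real.log (1 + t ^ 2) - 2 * Real.log t) t := by
    intro t ht
    have h1 : HasDerivAt (fun t : ℝ => t + t⁻¹) (1 + -(t ^ 2)⁻¹) t :=
      (hasDerivAt_id t).add (hasDerivAt_inv ht.ne')
    have h2 : HasDerivAt (fun t : ℝ => 1 + t ^ 2) (2 * t) t := by
      simpa using (hasDerivAt_pow 2 t).const_add 1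
    have h3 := h2.log (by positivity)
    have h4 := (Real.hasDerivAt_mul_log ht.ne').const_mul 2
    refine ((h1.mul h3).sub h4).congr_deriv ?_
    field_simp
    ring
  have hmono : MonotoneOn g (Set.Icc x 1) := by
    refine monotoneOn_of_deriv_nonneg (convex_Icc x 1)
      (fun t ht => (hder t (hx.trans_le ht.1)).continuousAt.continuousWithinAt)
      (fun t ht => ?_) (fun t ht => ?_) <;> rw [interior_Icc] at ht
    · exact (hder t (hx.trans ht.1)).differentiableAt.differentiableWithinAt
    · have ht0 : 0 < t := hx.trans ht.1
      rw [(hder t ht0).deriv]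
      have hy1 : t ^ 2 ≤ 1 := pow_le_one₀ ht0.le ht.2.le
      have hy : 0 < t ^ 2 := by positivity
      have e1 : Real.log (1 + t ^ 2) ≤ t ^ 2 := by
        linarith [Real.log_le_sub_one_of_pos (show 0 < 1 + t ^ 2 by positivity)]
      have e2 := Real.log_le_sub_one_of_pos hy
      have e3 : Real.log (t ^ 2) = 2 * Real.log t := by simp
      have e4 : (1 - t ^ 2) * Real.log (1 + t ^ 2) + t ^ 2 * Real.log (t ^ 2) ≤ 0 := by
        nlinarith [mul_le_mul_of_nonneg_left e1 (sub_nonneg.2 hy1),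
          mul_le_mul_of_nonneg_left e2 hy.le]
      have e5 : (1 - (t ^ 2)⁻¹) * Real.log (1 + t ^ 2) - 2 * Real.log t
          = -((1 - t ^ 2) * Real.log (1 + t ^ 2) + t ^ 2 * Real.log (t ^ 2)) / t ^ 2 := by
        rw [e3]
        field_simp
        ring
      rw [e5]
      exact div_nonneg (neg_nonneg.2 e4) hy.le
  have hg := hmono (Set.left_mem_Icc.2 hx1) (Set.right_mem_Icc.2 hx1) hx1
  have hg1 : g 1 = 2 * Real.log 2 := by norm_num [g]
  rw [hg1] at hg
  have hgx : (1 + x ^ 2) * Real.log (1 + x ^ 2) - x ^ 2 * Real.log (x ^ 2) = g x * x := by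
    simp only [g, Real.log_pow]
    field_simp
    push_cast
    ring
  rw [hgx]
  exact mul_le_mul_of_nonneg_right hg hx.le

theorem add_mul_log_add_le_of_le {a b : ℝ} (hb : 0 ≤ b) (hab : b ≤ a) :
    (a + b) * Real.log (a + b) ≤
      a * Real.log a + b * Real.log b + 2 * Real.log 2 * (√a * √b) := by
  rcases hb.eq_or_lt with rfl | hb
  · simp
  have ha : 0 < a := hb.trans_le hab
  have hx : 0 < √(b / a) := Real.sqrt_pos.2 (div_pos hb ha)
  have key := one_add_sq_mul_log_sub_le hx (Real.sqrt_le_one.2 ((div_le_one ha).2 hab))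
  rw [Real.sq_sqrt (div_pos hb ha).le, Real.sqrt_div hb.le] at key
  have e1 : Real.log (1 + b / a) = Real.log (a + b) - Real.log a := by
    rw [← Real.log_div (by positivity) ha.ne']
    congr 1
    field_simp
  rw [e1, Real.log_div hb.ne' ha.ne'] at key
  have key2 := mul_le_mul_of_nonneg_left key ha.le
  have hs : a * (√b / √a) = √a * √b := by
    have := Real.sqrt_pos.2 ha
    field_simp
    rw [Real.sq_sqrt ha.le]
  have e2 : a * (2 * Real.log 2 * (√b / √a)) = 2 * Real.log 2 * (√a * √b) := by
    rw [← hs]; ring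
  rw [e2] at key2
  have e3 : a * ((1 + b / a) * (Real.log (a + b) - Real.log a)
      - b / a * (Real.log b - Real.log a))
      = (a + b) * Real.log (a + b) - a * Real.log a - b * Real.log b := by
    field_simp
    ring
  rw [e3] at key2
  linarith

theorem add_mul_log_add_le {a b : ℝ} (ha : 0 ≤ a) (hb : 0 ≤ b) :
    (a + b) * Real.log (a + b) ≤
      a * Real.log a + b * Real.log b + 2 * Real.log 2 * (√a * √b) := by
  rcases le_total b a with h | h
  · exact add_mul_log_add_le_of_le hb h
  · have := add_mul_log_add_le_of_le ha h
    rw [add_comm b a, mul_comm √b] at this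
    linarith

/-- The homogeneous form of the entropy bound, in natural logarithms, together with the
subadditivity of the square root. -/
theorem sum_mul_log_sum_le {ι : Type*} (s : Finset ι) (f : ι → ℝ) (hf : ∀ i, 0 ≤ f i) :
    √(∑ i ∈ s, f i) ≤ ∑ i ∈ s, √(f i) ∧
    (∑ i ∈ s, f i) * Real.log (∑ i ∈ s, f i) ≤ ∑ i ∈ s, f i * Real.log (f i)
      + Real.log 2 * ((∑ i ∈ s, √(f i)) ^ 2 - ∑ i ∈ s, f i) := by
  classical
  induction s using Finset.induction_on with
  | empty => simp
  | insert i s hi ih =>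
    obtain ⟨ih1, ih2⟩ := ih
    simp only [Finset.sum_insert hi]
    have hS : 0 ≤ ∑ j ∈ s, f j := Finset.sum_nonneg fun j _ => hf j
    refine ⟨?_, ?_⟩
    · rw [Real.sqrt_le_left (add_nonneg (Real.sqrt_nonneg _) ((Real.sqrt_nonneg _).trans ih1))]
      nlinarith [Real.sq_sqrt (hf i), Real.sq_sqrt hS, Real.sqrt_nonneg (f i),
        Real.sqrt_nonneg (∑ j ∈ s, f j),
        mul_nonneg (Real.sqrt_nonneg (f i)) ((Real.sqrt_nonneg _).trans ih1),
        pow_le_pow_left₀ (Real.sqrt_nonneg _) ih1 2]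
    have hbin := add_mul_log_add_le (hf i) hS
    have hlog : 0 < Real.log 2 := Real.log_pos one_lt_two
    have hcross := mul_le_mul_of_nonneg_left
      (mul_le_mul_of_nonneg_left ih1 (Real.sqrt_nonneg (f i))) hlog.le
    have hexp : (√(f i) + ∑ j ∈ s, √(f j)) ^ 2 - (f i + ∑ j ∈ s, f j)
        = ((∑ j ∈ s, √(f j)) ^ 2 - ∑ j ∈ s, f j) + 2 * (√(f i) * ∑ j ∈ s, √(f j)) := by
      rw [add_sq, Real.sq_sqrt (hf i)]
      ring
    rw [hexp]
    linarith

/-- for nonnegative reals `λ_1, …, λ_n` summing to 1,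
`−∑ λ_i·log₂ λ_i ≤ (∑ √λ_i)² − 1` (with the convention `0·log₂ 0 = 0`, which holds
automatically since `Real.logb 2 0 = 0`). -/
theorem stmt17 {n : ℕ} (lam : Fin n → ℝ) (h0 : ∀ i, 0 ≤ lam i)
    (h1 : ∑ i, lam i = 1) :
    -∑ i, lam i * Real.logb 2 (lam i) ≤ (∑ i, Real.sqrt (lam i)) ^ 2 - 1 := by
  have h := (sum_mul_log_sum_le Finset.univ lam h0).2
  rw [h1, Real.log_one, mul_zero] at h
  have hsum : ∑ i, lam i * Real.logb 2 (lam i)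
      = (∑ i, lam i * Real.log (lam i)) / Real.log 2 := by
    simp only [Real.logb, Finset.sum_div, mul_div_assoc]
  rw [hsum, ← neg_div, div_le_iff₀ (Real.log_pos one_lt_two)]
  linarith
end

section
/- Let x ∈ ℂ^n be a unit vector and define C_{ℓ1} = ∑_{i ≠ j} |x_i|·|x_j| (the ℓ1-norm of coherence of the pure state |x⟩⟨x|) and C_r = −∑_{i=1}^n |x_i|²·log₂(|x_i|²) (the relative entropy of coherence of |x⟩⟨x|, with the convention 0·log₂(0) = 0). Then C_{ℓ1} ≥ max( C_r , 2^{C_r} − 1 ). -/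
open BigOperators

theorem hasDerivAt_log_two_sub_binary {r : ℝ} (hr : 0 < r) :
    HasDerivAt (fun r : ℝ => 2 * Real.log 2 - (r⁻¹ + r) * Real.log (1 + r ^ 2) + 2 * (r * Real.log r))
      ((1 / r ^ 2 - 1) * Real.log (1 + r ^ 2) + 2 * Real.log r) r := by
  have h1 : (1 + r ^ 2 : ℝ) ≠ 0 := by positivity
  have hlog : HasDerivAt (fun r : ℝ => Real.log (1 + r ^ 2)) (2 * r / (1 + r ^ 2)) r := by
    simpa using ((hasDerivAt_pow 2 r).const_add 1).log h1
  have h := ((((hasDerivAt_inv hr.ne').add (hasDerivAt_id r)).mul hlog).const_sub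
    (2 * Real.log 2)).add ((Real.hasDerivAt_mul_log hr.ne').const_mul 2)
  refine h.congr_deriv ?_
  simp only [Pi.add_apply, id]
  field_simp
  ring

theorem one_sub_mul_log_one_add_le {s : ℝ} (h0 : 0 < s) (h1 : s ≤ 1) :
    (1 - s) * Real.log (1 + s) ≤ -(s * Real.log s) := by
  have h2 : Real.log (1 + s) ≤ s := by
    linarith [Real.log_le_sub_one_of_pos (show 0 < 1 + s by linarith)]
  have h3 := Real.log_le_sub_one_of_pos h0
  nlinarith [mul_le_mul_of_nonneg_left h2 (sub_nonneg.2 h1), mul_le_mul_of_nonneg_left h3 h0.le]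

theorem log_two_sub_binary_nonneg {r : ℝ} (h0 : 0 < r) (h1 : r ≤ 1) :
    0 ≤ 2 * Real.log 2 - (r⁻¹ + r) * Real.log (1 + r ^ 2) + 2 * (r * Real.log r) := by
  have hanti : AntitoneOn (fun r : ℝ =>
      2 * Real.log 2 - (r⁻¹ + r) * Real.log (1 + r ^ 2) + 2 * (r * Real.log r)) (Set.Icc r 1) := by
    refine antitoneOn_of_deriv_nonpos (convex_Icc r 1) ?_ ?_ ?_
    · exact fun t ht => (hasDerivAt_log_two_sub_binary
        (h0.trans_le ht.1)).continuousAt.continuousWithinAt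
    · intro t ht
      rw [interior_Icc] at ht
      exact (hasDerivAt_log_two_sub_binary
        (h0.trans ht.1)).differentiableAt.differentiableWithinAt
    · intro t ht
      rw [interior_Icc] at ht
      have ht0 : 0 < t := h0.trans ht.1
      rw [(hasDerivAt_log_two_sub_binary ht0).deriv]
      have hs := one_sub_mul_log_one_add_le (pow_pos ht0 2) (pow_le_one₀ ht0.le ht.2.le)
      rw [Real.log_pow] at hs
      have he : (1 / t ^ 2 - 1) * Real.log (1 + t ^ 2) + 2 * Real.log t =
          ((1 - t ^ 2) * Real.log (1 + t ^ 2) + t ^ 2 * (2 * Real.log t)) / t ^ 2 := by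
        field_simp
      rw [he]
      refine div_nonpos_of_nonpos_of_nonneg ?_ (by positivity)
      push_cast at hs
      linarith
  have h := hanti ⟨le_rfl, h1⟩ ⟨h1, le_rfl⟩ h1
  norm_num at h
  linarith

theorem binary_entropy_le_of_le {u v : ℝ} (hu : 0 ≤ u) (huv : u ≤ v) :
    (u ^ 2 + v ^ 2) * Real.log (u ^ 2 + v ^ 2) - u ^ 2 * Real.log (u ^ 2) -
      v ^ 2 * Real.log (v ^ 2) ≤ Real.log 2 * (2 * u * v) := by
  rcases hu.eq_or_lt with rfl | hu
  · simp
  have hv : 0 < v := hu.trans_le huv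
  have h := log_two_sub_binary_nonneg (div_pos hu hv) ((div_le_one hv).2 huv)
  have e : (1 + (u / v) ^ 2) = (u ^ 2 + v ^ 2) / v ^ 2 := by field_simp; ring
  rw [e, Real.log_div (by positivity) (by positivity), Real.log_div hu.ne' hv.ne'] at h
  rw [Real.log_pow] at h ⊢
  rw [Real.log_pow]
  have h' := mul_nonneg (mul_pos hu hv).le h
  push_cast at h' ⊢
  field_simp at h'
  linarith

theorem binary_entropy_le {u v : ℝ} (hu : 0 ≤ u) (hv : 0 ≤ v) :
    (u ^ 2 + v ^ 2) * Real.log (u ^ 2 + v ^ 2) - u ^ 2 * Real.log (u ^ 2) -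
      v ^ 2 * Real.log (v ^ 2) ≤ Real.log 2 * (2 * u * v) := by
  rcases le_total u v with h | h
  · exact binary_entropy_le_of_le hu h
  · have := binary_entropy_le_of_le hv h
    rw [add_comm (v ^ 2)] at this
    linarith

theorem entropy_le_log_two_mul_sum_sq_sub {ι : Type*} (s : Finset ι) {a : ι → ℝ}
    (ha : ∀ i, 0 ≤ a i) :
    (∑ i ∈ s, a i ^ 2) * Real.log (∑ i ∈ s, a i ^ 2) - ∑ i ∈ s, a i ^ 2 * Real.log (a i ^ 2) ≤
      Real.log 2 * ((∑ i ∈ s, a i) ^ 2 - ∑ i ∈ s, a i ^ 2) := by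
  classical
  induction s using Finset.induction_on with
  | empty => simp
  | insert k s hk ih =>
    rw [Finset.sum_insert hk, Finset.sum_insert hk, Finset.sum_insert hk]
    have hT : 0 ≤ ∑ i ∈ s, a i ^ 2 := Finset.sum_nonneg fun i _ => sq_nonneg _
    have hS : 0 ≤ ∑ i ∈ s, a i := Finset.sum_nonneg fun i _ => ha i
    have hb := binary_entropy_le (ha k) (Real.sqrt_nonneg (∑ i ∈ s, a i ^ 2))
    rw [Real.sq_sqrt hT] at hb
    have hTS : √(∑ i ∈ s, a i ^ 2) ≤ ∑ i ∈ s, a i :=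
      (Real.sqrt_le_left hS).2 (Finset.sum_sq_le_sq_sum_of_nonneg fun i _ => ha i)
    have hm := mul_le_mul_of_nonneg_left hTS
      (mul_nonneg (Real.log_nonneg one_le_two) (mul_nonneg zero_le_two (ha k)))
    linarith

theorem neg_sq_mul_log_sq_le {a S : ℝ} (ha : 0 ≤ a) (hS : 0 < S) :
    -(a ^ 2 * Real.log (a ^ 2)) ≤ a ^ 2 * Real.log (S ^ 2) + 2 * (a / S - a ^ 2) := by
  rcases ha.eq_or_lt with rfl | ha
  · simp
  have h := mul_le_mul_of_nonneg_left
    (Real.log_le_sub_one_of_pos (inv_pos.2 (mul_pos ha hS))) (sq_nonneg a)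
  rw [Real.log_inv, Real.log_mul ha.ne' hS.ne'] at h
  have e : a ^ 2 * ((a * S)⁻¹ - 1) = a / S - a ^ 2 := by field_simp
  rw [e] at h
  rw [Real.log_pow, Real.log_pow]
  push_cast
  linarith

theorem entropy_le_log_sum_sq {ι : Type*} [Fintype ι] {a : ι → ℝ} (ha : ∀ i, 0 ≤ a i)
    (h1 : ∑ i, a i ^ 2 = 1) (hS : 0 < ∑ i, a i) :
    -∑ i, a i ^ 2 * Real.log (a i ^ 2) ≤ Real.log ((∑ i, a i) ^ 2) := by
  have h := Finset.sum_le_sum fun i (_ : i ∈ Finset.univ) => neg_sq_mul_log_sq_le (ha i) hS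
  rw [Finset.sum_neg_distrib, Finset.sum_add_distrib, ← Finset.sum_mul, ← Finset.mul_sum,
    Finset.sum_sub_distrib, ← Finset.sum_div, h1, div_self hS.ne'] at h
  linarith

theorem sum_sum_ne_mul {ι : Type*} [Fintype ι] [DecidableEq ι] (a : ι → ℝ) :
    (∑ i, ∑ j, if i ≠ j then a i * a j else 0) = (∑ i, a i) ^ 2 - ∑ i, a i ^ 2 := by
  have h (i j : ι) : (if i ≠ j then a i * a j else 0) =
      a i * a j - if i = j then a i * a j else 0 := by
    split_ifs <;> simp_all
  simp [h, Finset.sum_sub_distrib, sq, Finset.sum_mul_sum]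

/-- for a unit vector `x ∈ ℂ^n`, with
`C_ℓ1 = ∑_{i ≠ j} |x_i|·|x_j|` and `C_r = −∑ |x_i|²·log₂ |x_i|²`, one has
`C_ℓ1 ≥ max (C_r) (2^{C_r} − 1)`. -/
theorem stmt18 {n : ℕ} (x : Fin n → ℂ) (hx : ∑ i, ‖x i‖ ^ 2 = 1) :
    max (-∑ i, ‖x i‖ ^ 2 * Real.logb 2 (‖x i‖ ^ 2))
        ((2 : ℝ) ^ (-∑ i, ‖x i‖ ^ 2 * Real.logb 2 (‖x i‖ ^ 2)) - 1) ≤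
      ∑ i, ∑ j, if i ≠ j then ‖x i‖ * ‖x j‖ else 0 := by
  have ha (i : Fin n) : 0 ≤ ‖x i‖ := norm_nonneg _
  have hS : 0 < ∑ i, ‖x i‖ := by
    refine (Finset.sum_nonneg fun i _ => ha i).lt_of_ne fun h => ?_
    have h0 := (Finset.sum_eq_zero_iff_of_nonneg fun i _ => ha i).1 h.symm
    rw [Finset.sum_eq_zero fun i hi => by rw [h0 i hi]; simp] at hx
    exact zero_ne_one hx
  have hl : 0 < Real.log 2 := Real.log_pos one_lt_two
  have hC : -∑ i, ‖x i‖ ^ 2 * Real.logb 2 (‖x i‖ ^ 2) =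
      (-∑ i, ‖x i‖ ^ 2 * Real.log (‖x i‖ ^ 2)) / Real.log 2 := by
    simp only [Real.logb, neg_div, Finset.sum_div, mul_div_assoc]
  rw [sum_sum_ne_mul, hx, hC]
  refine max_le ?_ (sub_le_sub_right ?_ 1)
  · rw [div_le_iff₀ hl]
    have h := entropy_le_log_two_mul_sum_sq_sub Finset.univ ha
    rw [hx, Real.log_one] at h
    linarith
  · rw [← Real.le_logb_iff_rpow_le one_lt_two (by positivity), Real.logb]
    exact div_le_div_of_nonneg_right (entropy_le_log_sum_sq ha hx hS) hl.le
end

section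
/- Let x_1, …, x_n be nonnegative real numbers with ∑_{j=1}^n x_j² = 1, and let y = ∑_{j=1}^n x_j e_j ⊗ e_j be the corresponding unit vector in ℂ^n ⊗ ℂ^n (so the x_j are the Schmidt coefficients of y). Let N(|y⟩⟨y|) = (‖(|y⟩⟨y|)^Γ‖_tr − 1)/2 be the negativity, where Γ denotes the partial transpose. Then the entropy of entanglement (which for pure states equals the relative entropy of entanglement and the distillable entanglement) E_r(|y⟩⟨y|) = −∑_{j=1}^n x_j²·log₂(x_j²) satisfies E_r(|y⟩⟨y|) ≤ 2·N(|y⟩⟨y|). -/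
open Matrix BigOperators
open scoped ComplexOrder

/-- On `(0, 1/2]`, `-p log p` dominates `-(1 - p) log (1 - p)`. -/
lemma negMulLog_one_sub_le {p : ℝ} (h0 : 0 < p) (h1 : p < 1 / 2) :
    Real.negMulLog (1 - p) ≤ Real.negMulLog p := by
  have hq : 0 < 1 - p := by linarith
  have h := (strictConcaveOn_log_Ioi.concaveOn.slope_anti (x := 1) (by simp))
    (a := p) (b := 1 - p) ⟨h0, by simp; linarith⟩ ⟨hq, by simp; linarith⟩ (by linarith)
  simp only [slope_def_field, Real.log_one, sub_zero] at h
  have e1 : Real.log (1 - p) / (1 - p - 1) = -Real.log (1 - p) / p := by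
    rw [sub_sub_cancel_left, div_neg, neg_div]
  have e2 : Real.log p / (p - 1) = -Real.log p / (1 - p) := by
    rw [← neg_sub 1 p, div_neg, neg_div]
  rw [e1, e2, div_le_div_iff₀ h0 hq] at h
  simp only [Real.negMulLog]
  linarith

lemma binEntropy_sq_le_of_le_half {p : ℝ} (h0 : 0 < p) (h1 : p ≤ 1 / 2) :
    Real.binEntropy p ^ 2 ≤ (2 * Real.log 2) ^ 2 * (p * (1 - p)) := by
  have hderiv : ∀ t ∈ Set.Icc p (1 / 2), HasDerivAt
      (fun t => Real.binEntropy t ^ 2 / (t * (1 - t)))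
      (Real.binEntropy t * (Real.negMulLog t - Real.negMulLog (1 - t)) / (t * (1 - t)) ^ 2) t := by
    intro t ht
    have ht0 : 0 < t := h0.trans_le ht.1
    have ht1 : 0 < 1 - t := by linarith [ht.2]
    have hw : HasDerivAt (fun t : ℝ => t * (1 - t)) (1 * (1 - t) + t * (-1)) t :=
      (hasDerivAt_id t).mul ((hasDerivAt_id t).const_sub 1)
    refine (((Real.hasDerivAt_binEntropy ht0.ne' (by linarith)).pow 2).div hw
      (mul_pos ht0 ht1).ne').congr_deriv ?_
    congr 1
    simp only [Pi.pow_apply]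
    rw [Real.binEntropy_eq_negMulLog_add_negMulLog_one_sub]
    simp only [Real.negMulLog]
    push_cast
    ring
  have hmono : MonotoneOn (fun t => Real.binEntropy t ^ 2 / (t * (1 - t))) (Set.Icc p (1 / 2)) := by
    refine monotoneOn_of_deriv_nonneg (convex_Icc _ _)
      (fun t ht => (hderiv t ht).continuousAt.continuousWithinAt)
      (fun t ht => (hderiv t (interior_subset ht)).differentiableAt.differentiableWithinAt) ?_
    intro t ht
    rw [(hderiv t (interior_subset ht)).deriv]
    rw [interior_Icc] at ht
    have ht0 : 0 < t := h0.trans ht.1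
    exact div_nonneg (mul_nonneg (Real.binEntropy_nonneg ht0.le (by linarith [ht.2]))
      (sub_nonneg.2 (negMulLog_one_sub_le ht0 ht.2))) (sq_nonneg _)
  have h := hmono ⟨le_rfl, h1⟩ ⟨h1, le_rfl⟩ h1
  have hw : 0 < p * (1 - p) := mul_pos h0 (by linarith)
  simp only [one_div, Real.binEntropy_two_inv] at h
  rw [div_le_iff₀ hw] at h
  refine h.trans_eq ?_
  ring

lemma binEntropy_le_sqrt {p : ℝ} (h0 : 0 < p) (h1 : p < 1) :
    Real.binEntropy p ≤ 2 * Real.log 2 * √(p * (1 - p)) := by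
  have hsq : Real.binEntropy p ^ 2 ≤ (2 * Real.log 2) ^ 2 * (p * (1 - p)) := by
    rcases le_total p (1 / 2) with h | h
    · exact binEntropy_sq_le_of_le_half h0 h
    · have := binEntropy_sq_le_of_le_half (p := 1 - p) (by linarith) (by linarith)
      rwa [Real.binEntropy_one_sub, sub_sub_cancel, mul_comm (1 - p)] at this
  have hlog : 0 ≤ 2 * Real.log 2 := by positivity
  refine (Real.le_sqrt_of_sq_le hsq).trans_eq ?_
  rw [Real.sqrt_mul (sq_nonneg _), Real.sqrt_sq hlog]

lemma negMulLog_add_sub_le_sqrt {a b : ℝ} (ha : 0 ≤ a) (hb : 0 ≤ b) :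
    Real.negMulLog a + Real.negMulLog b - Real.negMulLog (a + b) ≤
      2 * Real.log 2 * √(a * b) := by
  rcases ha.eq_or_lt with rfl | ha
  · simp
  rcases hb.eq_or_lt with rfl | hb
  · simp
  have hs : 0 < a + b := by positivity
  have hq : 1 - a / (a + b) = b / (a + b) := by field_simp; ring
  have h := binEntropy_le_sqrt (p := a / (a + b)) (by positivity)
    ((div_lt_one hs).2 (by linarith))
  rw [Real.binEntropy_eq_negMulLog_add_negMulLog_one_sub, hq, div_mul_div_comm,
    Real.sqrt_div (by positivity), Real.sqrt_mul_self hs.le] at h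
  simp only [Real.negMulLog, Real.log_div ha.ne' hs.ne', Real.log_div hb.ne' hs.ne'] at h ⊢
  have h' := mul_le_mul_of_nonneg_left h hs.le
  field_simp at h'
  linarith

/-- The entropy of a nonnegative vector is bounded by its off-diagonal `ℓ¹` mass. -/
lemma sum_negMulLog_sq_sub_le {ι : Type*} (s : Finset ι) (x : ι → ℝ) (hx : ∀ j, 0 ≤ x j) :
    ∑ j ∈ s, Real.negMulLog (x j ^ 2) - Real.negMulLog (∑ j ∈ s, x j ^ 2) ≤
      Real.log 2 * ((∑ j ∈ s, x j) ^ 2 - ∑ j ∈ s, x j ^ 2) := by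
  classical
  induction s using Finset.induction_on with
  | empty => simp
  | insert a s ha ih =>
    have hS : 0 ≤ ∑ j ∈ s, x j := Finset.sum_nonneg fun j _ => hx j
    have hQ : 0 ≤ ∑ j ∈ s, x j ^ 2 := Finset.sum_nonneg fun j _ => sq_nonneg _
    have h2 := negMulLog_add_sub_le_sqrt (sq_nonneg (x a)) hQ
    have h3 : √(x a ^ 2 * ∑ j ∈ s, x j ^ 2) ≤ x a * ∑ j ∈ s, x j := by
      rw [Real.sqrt_mul (sq_nonneg _), Real.sqrt_sq (hx a)]
      refine mul_le_mul_of_nonneg_left (Real.sqrt_le_iff.2 ⟨hS, ?_⟩) (hx a)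
      exact Finset.sum_sq_le_sq_sum_of_nonneg fun j _ => hx j
    have h4 := mul_le_mul_of_nonneg_left h3 (by positivity : 0 ≤ 2 * Real.log 2)
    simp only [Finset.sum_insert ha]
    nlinarith

lemma re_trace_mul_unitary_le_traceNorm {m : Type*} [Fintype m] [DecidableEq m]
    {A U : Matrix m m ℂ} (hA : A.IsHermitian) (hU : U ∈ Matrix.unitaryGroup m ℂ) :
    (A * U).trace.re ≤ traceNorm A := by
  rw [traceNorm, dif_pos hA]
  set V := hA.eigenvectorUnitary with hV
  set W : Matrix m m ℂ := star (V : Matrix m m ℂ) * U * V with hW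
  have hWu : W ∈ Matrix.unitaryGroup m ℂ := mul_mem (mul_mem (star V).2 hU) V.2
  have htr : (A * U).trace = ∑ i, (hA.eigenvalues i : ℂ) * W i i := by
    conv_lhs => rw [hA.spectral_theorem, Unitary.conjStarAlgAut_apply]
    rw [Matrix.mul_assoc, Matrix.mul_assoc, Matrix.trace_mul_comm, Matrix.mul_assoc, ← hV, ← hW]
    simp [Matrix.trace, Matrix.diagonal_mul]
  rw [htr, Complex.re_sum]
  refine Finset.sum_le_sum fun i _ => ?_
  calc ((hA.eigenvalues i : ℂ) * W i i).re ≤ ‖(hA.eigenvalues i : ℂ) * W i i‖ :=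
        Complex.re_le_norm _
    _ = |hA.eigenvalues i| * ‖W i i‖ := by simp
    _ ≤ |hA.eigenvalues i| :=
        mul_le_of_le_one_right (abs_nonneg _) (entry_norm_bound_of_unitary hWu i i)

lemma outer_isHermitian {m : Type*} (y : m → ℂ) : (outer y).IsHermitian := by
  ext i j
  simp [outer, mul_comm]

lemma ptrans_isHermitian {n : ℕ} {σ : Matrix (Fin n × Fin n) (Fin n × Fin n) ℂ}
    (hσ : σ.IsHermitian) : (ptrans σ).IsHermitian := by
  ext p q
  exact hσ.apply _ _

lemma permMatrix_mem_unitaryGroup {m : Type*} [Fintype m] [DecidableEq m] (e : Equiv.Perm m) :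
    e.permMatrix ℂ ∈ Matrix.unitaryGroup m ℂ := by
  rw [Matrix.mem_unitaryGroup_iff, Matrix.star_eq_conjTranspose, Matrix.conjTranspose_permMatrix,
    ← Matrix.permMatrix_mul]
  simp

/-- The trace norm of the partial transpose of a pure state in Schmidt form is at least the
square of the sum of its Schmidt coefficients. -/
lemma sum_sq_le_traceNorm_ptrans_outer {n : ℕ} (x : Fin n → ℝ) :
    (∑ j, x j) ^ 2 ≤ traceNorm (ptrans
      (outer fun p : Fin n × Fin n => if p.1 = p.2 then (x p.1 : ℂ) else 0)) := by
  set y : Fin n × Fin n → ℂ := fun p => if p.1 = p.2 then (x p.1 : ℂ) else 0 with hy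
  let e : Equiv.Perm (Fin n × Fin n) := Equiv.prodComm _ _
  refine le_trans (le_of_eq ?_) (re_trace_mul_unitary_le_traceNorm
    (ptrans_isHermitian (outer_isHermitian y)) (permMatrix_mem_unitaryGroup e))
  rw [Matrix.trace, Complex.re_sum, pow_two, Finset.sum_mul_sum, ← Finset.sum_product',
    Finset.univ_product_univ]
  refine Finset.sum_congr rfl fun p _ => ?_
  simp [PEquiv.mul_toMatrix_toPEquiv, ptrans, outer, e, hy, mul_comm]

/-- for nonnegative reals `x_1, …, x_n` with `∑ x_j² = 1` and
`y = ∑ x_j e_j ⊗ e_j ∈ ℂ^n ⊗ ℂ^n`, the entropy of entanglement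
`E_r(|y⟩⟨y|) = −∑ x_j² log₂ x_j²` is at most `2·N(|y⟩⟨y|)`, where
`N(ρ) = (‖ρ^Γ‖_tr − 1)/2` is the negativity. -/
theorem stmt19 {n : ℕ} (x : Fin n → ℝ) (hx : ∀ j, 0 ≤ x j)
    (h1 : ∑ j, (x j) ^ 2 = 1) :
    -∑ j, (x j) ^ 2 * Real.logb 2 ((x j) ^ 2) ≤
      2 * ((traceNorm (ptrans
        (outer fun p : Fin n × Fin n => if p.1 = p.2 then (x p.1 : ℂ) else 0)) - 1) / 2) := by
  have hent := sum_negMulLog_sq_sub_le Finset.univ x hx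
  have htr := sum_sq_le_traceNorm_ptrans_outer x
  rw [h1, Real.negMulLog_one, sub_zero] at hent
  have hlog : 0 < Real.log 2 := Real.log_pos one_lt_two
  have hE : -∑ j, (x j) ^ 2 * Real.logb 2 ((x j) ^ 2) =
      (∑ j, Real.negMulLog (x j ^ 2)) / Real.log 2 := by
    rw [Finset.sum_div, ← Finset.sum_neg_distrib]
    refine Finset.sum_congr rfl fun j _ => ?_
    rw [Real.negMulLog, Real.logb]
    ring
  rw [hE, mul_div_cancel₀ _ two_ne_zero, div_le_iff₀' hlog]
  exact hent.trans (mul_le_mul_of_nonneg_left (by linarith) hlog.le)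
end
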